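/- arXiv:1210.0648 — 4 statements merged into one kernel-verified Lean document; each statement's English description precedes it below -/
import Mathlib

section
/- For n ≥ 1, the set of Poincaré series { P(M) : M a Coxeter matrix on {1,…,n} with m_{ij} ∈ {3,4,6,∞} for all i≠j } ⊆ ℤ⟦t⟧ is finite of cardinality at most the binomial coefficient C(n(n−1)/2 + 3, 3). -/
open PowerSeries

/-- The Poincaré series of (the Coxeter group of) a Coxeter matrix: the generating
function of the number of elements of each length in its Coxeter group. -/
noncomputable def coxPoincare {B : Type*} (M : CoxeterMatrix B) : PowerSeries ℤ :=
  PowerSeries.mk fun k =>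
    (Nat.card {w : M.Group // M.toCoxeterSystem.length w = k} : ℤ)

namespace CoxP

section Refl
variable {V : Type*} [AddCommGroup V]

/-- abstract reflection -/
def rfl0 (p : V →ₗ[ℤ] ℤ) (a : V) : Module.End ℤ V := 1 - p.smulRight a

theorem rfl0_apply (p : V →ₗ[ℤ] ℤ) (a v : V) : rfl0 p a v = v - p v • a := rfl

theorem rfl0_sq (p : V →ₗ[ℤ] ℤ) (a : V) (h : p a = 2) : rfl0 p a * rfl0 p a = 1 := by
  ext v
  simp only [Module.End.mul_apply, rfl0_apply, map_sub, map_smul, h, Module.End.one_apply,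
    smul_eq_mul]
  module

theorem braid0 (p q : V →ₗ[ℤ] ℤ) (a b : V) (x y : ℤ) (hpa : p a = 2) (hqb : q b = 2)
    (hpb : p b = -x) (hqa : q a = -y) (m : ℕ)
    (h : (m = 3 ∧ x = 1 ∧ y = 1) ∨ (m = 4 ∧ x = 1 ∧ y = 2) ∨ (m = 4 ∧ x = 2 ∧ y = 1) ∨
      (m = 6 ∧ x = 1 ∧ y = 3) ∨ (m = 6 ∧ x = 3 ∧ y = 1)) :
    (rfl0 p a * rfl0 q b) ^ m = 1 := by
  have key : ∀ v, ∀ r s : ℤ, (rfl0 p a * rfl0 q b) (v + r • a + s • b) =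
      v + (-r - x * s - p v - x * q v + x * y * r) • a
        + (-s - q v + y * r) • b := by
    intro v r s
    simp only [Module.End.mul_apply, rfl0_apply, map_sub, map_add, map_smul, hpa, hpb, hqa, hqb,
      smul_eq_mul]
    module
  have key0 : ∀ v, (rfl0 p a * rfl0 q b) v = v + (- p v - x * q v) • a + (- q v) • b := by
    intro v
    have := key v 0 0
    simpa using this
  ext v
  rcases h with ⟨rfl, rfl, rfl⟩ | ⟨rfl, rfl, rfl⟩ | ⟨rfl, rfl, rfl⟩ | ⟨rfl, rfl, rfl⟩ |
    ⟨rfl, rfl, rfl⟩ <;>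
  · simp only [pow_succ', pow_zero, Module.End.mul_apply (rfl0 p a * rfl0 q b), mul_one,
      Module.End.one_apply]
    simp only [key0 v]
    simp only [key]
    module

end Refl

/-- allowed labels -/
def Good {n : ℕ} (M : CoxeterMatrix (Fin n)) : Prop :=
  ∀ i j : Fin n, i ≠ j → M i j = 3 ∨ M i j = 4 ∨ M i j = 6 ∨ M i j = 0

/-- the Cartan matrix -/
def A {n : ℕ} (M : CoxeterMatrix (Fin n)) (i j : Fin n) : ℤ :=
  if i = j then 2 else if M i j = 0 then -2 else if i < j then -1 else
    if M i j = 3 then -1 else if M i j = 4 then -2 else -3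

variable {n : ℕ} {M : CoxeterMatrix (Fin n)} {W : Type*} [Group W]

theorem A_self (i : Fin n) : A M i i = 2 := by simp [A]

theorem A_cases (hM : Good M) {i j : Fin n} (h : i ≠ j) :
    (M i j = 0 ∧ A M i j = -2 ∧ A M j i = -2) ∨
    (M i j = 3 ∧ A M i j = -1 ∧ A M j i = -1) ∨
    (M i j = 4 ∧ A M i j = -1 ∧ A M j i = -2) ∨
    (M i j = 4 ∧ A M i j = -2 ∧ A M j i = -1) ∨
    (M i j = 6 ∧ A M i j = -1 ∧ A M j i = -3) ∨
    (M i j = 6 ∧ A M i j = -3 ∧ A M j i = -1) := by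
  have hs := M.symmetric j i
  rcases lt_or_gt_of_ne h with h' | h' <;>
  rcases hM i j h with h1 | h1 | h1 | h1 <;>
  simp [A, h, h.symm, hs, h1, h', h'.not_gt]

theorem A_le (hM : Good M) {i j : Fin n} (h : i ≠ j) : A M i j ≤ -1 := by
  rcases A_cases hM h with h | h | h | h | h | h <;> omega

/-- pairing with a coroot -/
def pr (M : CoxeterMatrix (Fin n)) (i : Fin n) : (Fin n → ℤ) →ₗ[ℤ] ℤ :=
  ∑ j, A M i j • LinearMap.proj j

/-- simple root -/
def al (i : Fin n) : Fin n → ℤ := Pi.single i 1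

theorem pr_al (i j : Fin n) : pr M i (al j) = A M i j := by
  simp [pr, al, Pi.single_apply]

/-- simple reflection -/
def rf (M : CoxeterMatrix (Fin n)) (i : Fin n) : Module.End ℤ (Fin n → ℤ) := rfl0 (pr M i) (al i)

theorem rf_apply (i : Fin n) (v : Fin n → ℤ) : rf M i v = v - pr M i v • al i := rfl

theorem rf_liftable (hM : Good M) : M.IsLiftable (rf M) := by
  intro i j
  by_cases h : i = j
  · subst h
    simp only [CoxeterMatrix.diagonal, pow_one]
    exact rfl0_sq _ _ (by rw [pr_al, A_self])
  · by_cases h0 : M i j = 0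
    · rw [h0, pow_zero]
    apply braid0 _ _ _ _ (-A M i j) (-A M j i)
    · rw [pr_al, A_self]
    · rw [pr_al, A_self]
    · rw [pr_al, neg_neg]
    · rw [pr_al, neg_neg]
    · rcases A_cases hM h with h | h | h | h | h | h <;> omega

/-- the geometric representation -/
noncomputable def rho (cs : CoxeterSystem M W) (hM : Good M) : W →* Module.End ℤ (Fin n → ℤ) :=
  cs.lift ⟨rf M, rf_liftable hM⟩

theorem rho_simple (cs : CoxeterSystem M W) (hM : Good M) (i : Fin n) :
    rho cs hM (cs.simple i) = rf M i :=
  cs.lift_apply_simple _ i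

theorem rf_pair_left {i j : Fin n} (a b : ℤ) :
    rf M i (a • al i + b • al j) = (- a - A M i j * b) • al i + b • al j := by
  rw [rf_apply]
  simp only [map_add, map_smul, pr_al, A_self, smul_eq_mul]
  module

theorem rf_pair_right {i j : Fin n} (a b : ℤ) :
    rf M j (a • al i + b • al j) = a • al i + (- b - A M j i * a) • al j := by
  rw [rf_apply]
  simp only [map_add, map_smul, pr_al, A_self, smul_eq_mul]
  module

open CoxeterSystem

theorem rho_alt (cs : CoxeterSystem M W) (hM : Good M) {i j : Fin n} (h : i ≠ j) (k : ℕ) (hk : M i j = 0 ∨ k < M i j) :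
    ∃ a b : ℤ, 0 ≤ a ∧ 0 ≤ b ∧
      rho cs hM (cs.wordProd (alternatingWord i j k)) (al i) = a • al i + b • al j := by
  have hz : rho cs hM (cs.wordProd (alternatingWord i j 0)) (al i)
      = (1 : ℤ) • al i + (0 : ℤ) • al j := by
    simp [alternatingWord]
  have hs : ∀ k, ∀ a b : ℤ,
      rho cs hM (cs.wordProd (alternatingWord i j k)) (al i) = a • al i + b • al j →
      rho cs hM (cs.wordProd (alternatingWord i j (k + 1))) (al i)
       = if Even k then a • al i + (- b - A M j i * a) • al j
          else (- a - A M i j * b) • al i + b • al j := by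
    intro k a b hab
    rw [alternatingWord_succ', wordProd_cons, map_mul, Module.End.mul_apply, hab]
    split_ifs
    · rw [rho_simple, rf_pair_right]
    · rw [rho_simple, rf_pair_left]
  by_cases h0 : M i j = 0
  · have hA : A M i j = -2 ∧ A M j i = -2 := by
      rcases A_cases hM h with h | h | h | h | h | h <;> omega
    have : rho cs hM (cs.wordProd (alternatingWord i j k)) (al i)
       = if Even k then (k + 1 : ℤ) • al i + (k : ℤ) • al j
          else (k : ℤ) • al i + (k + 1 : ℤ) • al j := by
      clear hk
      induction k with
      | zero => simpa using hz
      | succ k ih =>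
        by_cases he : Even k
        · rw [if_pos he] at ih
          rw [hs _ _ _ ih, if_pos he, if_neg (by simpa [Nat.even_add_one] using he), hA.2]
          push_cast
          congr 2
          ring
        · rw [if_neg he] at ih
          rw [hs _ _ _ ih, if_neg he, if_pos (by simpa [Nat.even_add_one] using he), hA.1]
          push_cast
          congr 2
          ring
    split_ifs at this
    · exact ⟨_, _, by positivity, by positivity, this⟩
    · exact ⟨_, _, by positivity, by positivity, this⟩
  · have hk := hk.resolve_left h0
    have h1 := hs 0 _ _ hz
    rw [if_pos (by decide)] at h1
    have h2 := hs 1 _ _ h1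
    rw [if_neg (by decide)] at h2
    have h3 := hs 2 _ _ h2
    rw [if_pos (by decide)] at h3
    have h4 := hs 3 _ _ h3
    rw [if_neg (by decide)] at h4
    have h5 := hs 4 _ _ h4
    rw [if_pos (by decide)] at h5
    have hk6 : k < 6 := by
      rcases A_cases hM h with h | h | h | h | h | h <;> omega
    interval_cases k
    · exact ⟨_, _, by norm_num, by norm_num, hz⟩
    · refine ⟨_, _, ?_, ?_, h1⟩ <;>
      rcases A_cases hM h with ⟨h6, h7, h8⟩ | ⟨h6, h7, h8⟩ | ⟨h6, h7, h8⟩ | ⟨h6, h7, h8⟩ |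
        ⟨h6, h7, h8⟩ | ⟨h6, h7, h8⟩ <;> simp [h7, h8] <;> omega
    · refine ⟨_, _, ?_, ?_, h2⟩ <;>
      rcases A_cases hM h with ⟨h6, h7, h8⟩ | ⟨h6, h7, h8⟩ | ⟨h6, h7, h8⟩ | ⟨h6, h7, h8⟩ |
        ⟨h6, h7, h8⟩ | ⟨h6, h7, h8⟩ <;> simp [h7, h8] <;> omega
    · refine ⟨_, _, ?_, ?_, h3⟩ <;>
      rcases A_cases hM h with ⟨h6, h7, h8⟩ | ⟨h6, h7, h8⟩ | ⟨h6, h7, h8⟩ | ⟨h6, h7, h8⟩ |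
        ⟨h6, h7, h8⟩ | ⟨h6, h7, h8⟩ <;> simp [h7, h8] <;> omega
    · refine ⟨_, _, ?_, ?_, h4⟩ <;>
      rcases A_cases hM h with ⟨h6, h7, h8⟩ | ⟨h6, h7, h8⟩ | ⟨h6, h7, h8⟩ | ⟨h6, h7, h8⟩ |
        ⟨h6, h7, h8⟩ | ⟨h6, h7, h8⟩ <;> simp [h7, h8] <;> omega
    · refine ⟨_, _, ?_, ?_, h5⟩ <;>
      rcases A_cases hM h with ⟨h6, h7, h8⟩ | ⟨h6, h7, h8⟩ | ⟨h6, h7, h8⟩ | ⟨h6, h7, h8⟩ |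
        ⟨h6, h7, h8⟩ | ⟨h6, h7, h8⟩ <;> simp [h7, h8] <;> omega

section Main
variable (cs : CoxeterSystem M W)

theorem decomp {i j : Fin n} (w : W) (hj : cs.IsRightDescent w j) :
    ∃ (k : ℕ) (v : W), 1 ≤ k ∧ w = v * cs.wordProd (alternatingWord i j k) ∧
      cs.length v + k = cs.length w ∧ ¬ cs.IsRightDescent v i ∧ ¬ cs.IsRightDescent v j := by
  classical
  let P : ℕ → Prop := fun k => ∃ v : W, w = v * cs.wordProd (alternatingWord i j k) ∧
      cs.length v + k = cs.length w
  have h1 : P 1 := by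
    refine ⟨w * cs.simple j, ?_, ?_⟩
    · simp [alternatingWord]
    · exact cs.isRightDescent_iff.1 hj
  have hle : ∀ k, P k → k ≤ cs.length w := by
    rintro k ⟨v, -, h⟩
    omega
  obtain ⟨k, hk1, hPk, hPk'⟩ : ∃ k, 1 ≤ k ∧ P k ∧ ¬ P (k + 1) := by
    refine ⟨Nat.findGreatest P (cs.length w), Nat.le_findGreatest (hle 1 h1) h1,
      Nat.findGreatest_spec (hle 1 h1) h1, ?_⟩
    intro h
    have := Nat.le_findGreatest (hle _ h) h
    omega
  obtain ⟨v, hv, hl⟩ := hPk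
  have hx : ¬ cs.IsRightDescent v (if Even k then j else i) := by
    intro h
    apply hPk'
    refine ⟨v * cs.simple (if Even k then j else i), ?_, ?_⟩
    · rw [alternatingWord_succ', wordProd_cons, ← mul_assoc, mul_assoc v, cs.simple_mul_simple_self,
        mul_one, hv]
    · have := cs.isRightDescent_iff.1 h
      omega
  have hy : ¬ cs.IsRightDescent v (if Even k then i else j) := by
    intro h
    obtain ⟨k, rfl⟩ : ∃ k', k = k' + 1 := ⟨k - 1, by omega⟩
    have hy' : (if Even (k + 1) then i else j) = (if Even k then j else i) := by
      by_cases he : Even k <;> simp [Nat.even_add_one, he]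
    rw [hy'] at h
    have h2 := cs.isRightDescent_iff.1 h
    rw [alternatingWord_succ', wordProd_cons, ← mul_assoc] at hv
    have h3 := cs.length_mul_le (v * cs.simple (if Even k then j else i))
      (cs.wordProd (alternatingWord i j k))
    have h4 := cs.length_wordProd_le (alternatingWord i j k)
    rw [length_alternatingWord] at h4
    rw [← hv] at h3
    omega
  refine ⟨k, v, hk1, hv, hl, ?_⟩
  by_cases he : Even k
  · rw [if_pos he] at hx hy; exact ⟨hy, hx⟩
  · rw [if_neg he] at hx hy; exact ⟨hx, hy⟩

theorem alt_m (i j : Fin n) :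
    cs.wordProd (alternatingWord i j (M i j)) = cs.wordProd (alternatingWord j i (M i j)) := by
  have := cs.prod_alternatingWord_eq_prod_alternatingWord_sub i j (M i j) (by omega)
  rw [this]; congr 2; omega

theorem alt_succ (i j : Fin n) (k : ℕ) :
    cs.wordProd (alternatingWord i j (k + 1)) =
      cs.wordProd (alternatingWord j i k) * cs.simple j := by
  rw [alternatingWord_succ, wordProd_concat]

theorem length_alt_le (i j : Fin n) (k : ℕ) :
    cs.length (cs.wordProd (alternatingWord i j k)) ≤ k := by
  have h4 := cs.length_wordProd_le (alternatingWord i j k)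
  rwa [length_alternatingWord] at h4

theorem alt_lt {i j : Fin n} (w v : W) (hi : ¬ cs.IsRightDescent w i) (k : ℕ)
    (hw : w = v * cs.wordProd (alternatingWord i j k)) (hl : cs.length v + k = cs.length w)
    (h0 : M i j ≠ 0) : k < M i j := by
  by_contra hk
  have hr : cs.IsReduced (alternatingWord i j k) := by
    have h1 := cs.length_mul_le v (cs.wordProd (alternatingWord i j k))
    rw [← hw] at h1
    have h2 := length_alt_le cs i j k
    rw [CoxeterSystem.IsReduced, length_alternatingWord]
    omega
  have hk' : k = M i j := by
    by_contra hne
    exact cs.not_isReduced_alternatingWord i j h0 (by omega) hr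
  apply hi
  obtain ⟨m, hm⟩ : ∃ m, M i j = m + 1 := ⟨M i j - 1, by omega⟩
  have h5 := alt_m cs i j
  rw [hk', h5, hm, alt_succ] at hw
  have h6 : w * cs.simple i = v * cs.wordProd (alternatingWord i j m) := by
    rw [hw]; simp [mul_assoc]
  rw [IsRightDescent, h6]
  have h7 := cs.length_mul_le v (cs.wordProd (alternatingWord i j m))
  have h8 := length_alt_le cs i j m
  omega

theorem pos (hM : Good M) (w : W) (i : Fin n) (h : ¬ cs.IsRightDescent w i) :
    0 ≤ rho cs hM w (al i) := by
  induction hN : cs.length w using Nat.strong_induction_on generalizing w i with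
  | _ N ih =>
    by_cases hw : w = 1
    · subst hw
      simp [al]
    · obtain ⟨j, hj⟩ := cs.exists_rightDescent_of_ne_one hw
      have hij : i ≠ j := by rintro rfl; exact h hj
      obtain ⟨k, v, hk, hwv, hl, hvi, hvj⟩ := decomp cs (i := i) w hj
      have hkm : M i j = 0 ∨ k < M i j := by
        by_cases h0 : M i j = 0
        · exact Or.inl h0
        · exact Or.inr (alt_lt cs w v h k hwv hl h0)
      obtain ⟨a, b, ha, hb, hab⟩ := rho_alt cs hM hij k hkm
      have h1 := ih _ (by omega) v i hvi rfl
      have h2 := ih _ (by omega) v j hvj rfl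
      rw [hwv, map_mul, Module.End.mul_apply, hab, map_add, map_smul, map_smul]
      exact add_nonneg (smul_nonneg ha h1) (smul_nonneg hb h2)

theorem rho_inv_mul (hM : Good M) (w : W) (v : Fin n → ℤ) :
    rho cs hM w⁻¹ (rho cs hM w v) = v := by
  rw [← Module.End.mul_apply, ← map_mul]; simp

theorem rho_al_ne (hM : Good M) (w : W) (i : Fin n) : rho cs hM w (al i) ≠ 0 := by
  intro h
  have := rho_inv_mul cs hM w (al i)
  rw [h, map_zero] at this
  have := congrFun this i
  simp [al] at this

theorem neg_of_desc (hM : Good M) (w : W) (i : Fin n) (h : cs.IsRightDescent w i) :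
    rho cs hM w (al i) ≤ 0 := by
  have h1 := pos cs hM (w * cs.simple i) i (cs.isRightDescent_iff_not_isRightDescent_mul.1 h)
  rw [map_mul, Module.End.mul_apply, rho_simple, rf_apply, pr_al, A_self, map_sub, map_smul] at h1
  intro k
  have := h1 k
  simp at this ⊢
  omega

theorem not_desc_iff (hM : Good M) (w : W) (i : Fin n) :
    ¬ cs.IsRightDescent w i ↔ 0 ≤ rho cs hM w (al i) := by
  refine ⟨pos cs hM w i, fun h h' => ?_⟩
  exact rho_al_ne cs hM w i (le_antisymm (neg_of_desc cs hM w i h') h)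

/-- parabolic subgroup -/
def par (T : Finset (Fin n)) : Subgroup W := Subgroup.closure (cs.simple '' (T : Set (Fin n)))

theorem simple_mem_par {T : Finset (Fin n)} {i : Fin n} (h : i ∈ T) : cs.simple i ∈ par cs T :=
  Subgroup.subset_closure ⟨i, h, rfl⟩

theorem par_mono {T U : Finset (Fin n)} (h : T ⊆ U) : par cs T ≤ par cs U :=
  Subgroup.closure_mono (Set.image_mono (by exact_mod_cast h))

theorem par_univ : par cs Finset.univ = ⊤ := by
  rw [par, Finset.coe_univ, Set.image_univ]
  exact cs.subgroup_closure_range_simple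

theorem rho_par (hM : Good M) (T : Finset (Fin n)) (w : W) (hw : w ∈ par cs T) :
    ∀ v : Fin n → ℤ, ∀ k, k ∉ T → rho cs hM w v k = v k := by
  have hs : ∀ i ∈ T, ∀ v : Fin n → ℤ, ∀ k, k ∉ T → rho cs hM (cs.simple i) v k = v k := by
    intro i hi v k hk
    have : k ≠ i := by rintro rfl; exact hk hi
    rw [rho_simple, rf_apply]
    simp [al, this]
  induction hw using Subgroup.closure_induction with
  | mem x hx =>
    obtain ⟨i, hi, rfl⟩ := hx
    exact hs i hi
  | one => simp
  | mul x y _ _ hx hy =>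
    intro v k hk
    rw [map_mul, Module.End.mul_apply, hx _ _ hk, hy _ _ hk]
  | inv x _ hx =>
    intro v k hk
    have h1 := hx (rho cs hM x⁻¹ v) k hk
    rw [← h1, ← Module.End.mul_apply, ← map_mul]
    simp

theorem par_eq_one (hM : Good M) (T : Finset (Fin n)) (w : W) (hw : w ∈ par cs T)
    (h : ∀ i ∈ T, ¬ cs.IsRightDescent w i) : w = 1 := by
  by_contra hne
  obtain ⟨j, hj⟩ := cs.exists_rightDescent_of_ne_one hne
  have hjT : j ∉ T := fun h' => h j h' hj
  have h1 := neg_of_desc cs hM w j hj j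
  rw [rho_par cs hM T w hw _ j hjT] at h1
  simp [al] at h1

theorem nonneg_comb (v : Fin n → ℤ) : v = ∑ i, v i • al i := by
  ext k
  simp [al, Pi.single_apply]

theorem add_length (hM : Good M) (T : Finset (Fin n)) (u v : W)
    (hu : ∀ i ∈ T, ¬ cs.IsRightDescent u i) (hv : v ∈ par cs T) :
    cs.length (u * v) = cs.length u + cs.length v := by
  induction hN : cs.length v using Nat.strong_induction_on generalizing v with
  | _ N ih =>
    by_cases h1 : v = 1
    · subst h1
      simp at hN
      simp [hN]
    · have : ∃ t ∈ T, cs.IsRightDescent v t := by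
        by_contra hcon
        push Not at hcon
        exact h1 (par_eq_one cs hM T v hv hcon)
      obtain ⟨t, ht, hd⟩ := this
      have hv' : v * cs.simple t ∈ par cs T := mul_mem hv (simple_mem_par cs ht)
      have hl := cs.isRightDescent_iff.1 hd
      have h2 := ih _ (by omega) (v * cs.simple t) hv' rfl
      have h3 : ¬ cs.IsRightDescent (u * (v * cs.simple t)) t := by
        rw [not_desc_iff cs hM, map_mul, Module.End.mul_apply]
        have h4 := pos cs hM (v * cs.simple t) t
          (cs.isRightDescent_iff_not_isRightDescent_mul.1 hd)
        have h5 := rho_par cs hM T _ hv' (al t)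
        generalize rho cs hM (v * cs.simple t) (al t) = x at h4 h5
        rw [nonneg_comb x, map_sum]
        refine Finset.sum_nonneg fun k _ => ?_
        rw [map_smul]
        by_cases hk : k ∈ T
        · exact smul_nonneg (h4 k) (pos cs hM u k (hu k hk))
        · have h6 : x k = 0 := by
            rw [h5 k hk]
            have : k ≠ t := by rintro rfl; exact hk ht
            simp [al, this]
          simp [h6]
      rw [cs.not_isRightDescent_iff, mul_assoc, mul_assoc, cs.simple_mul_simple_self, mul_one] at h3
      omega

theorem exists_fact (T : Finset (Fin n)) (w : W) :
    ∃ u v : W, w = u * v ∧ v ∈ par cs T ∧ ∀ i ∈ T, ¬ cs.IsRightDescent u i := by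
  induction hN : cs.length w using Nat.strong_induction_on generalizing w with
  | _ N ih =>
    by_cases h : ∃ t ∈ T, cs.IsRightDescent w t
    · obtain ⟨t, ht, hd⟩ := h
      have hl := cs.isRightDescent_iff.1 hd
      obtain ⟨u, v, h1, h2, h3⟩ := ih _ (by omega) (w * cs.simple t) rfl
      refine ⟨u, v * cs.simple t, ?_, mul_mem h2 (simple_mem_par cs ht), h3⟩
      rw [← mul_assoc, ← h1]; simp
    · push Not at h
      exact ⟨w, 1, by simp, one_mem _, h⟩

theorem fact_unique (hM : Good M) (T : Finset (Fin n)) (u v u' v' : W)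
    (hu : ∀ i ∈ T, ¬ cs.IsRightDescent u i) (hv : v ∈ par cs T)
    (hu' : ∀ i ∈ T, ¬ cs.IsRightDescent u' i) (hv' : v' ∈ par cs T) (h : u * v = u' * v') :
    u = u' ∧ v = v' := by
  have hx : v' * v⁻¹ ∈ par cs T := mul_mem hv' (inv_mem hv)
  have h1 : u = u' * (v' * v⁻¹) := by rw [← mul_assoc, ← h]; simp
  have h2 : u' = u * (v' * v⁻¹)⁻¹ := by rw [h1, mul_inv_cancel_right]
  have h3 := add_length cs hM T u' _ hu' hx
  have h4 := add_length cs hM T u _ hu (inv_mem hx)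
  rw [← h1] at h3
  rw [← h2] at h4
  have h5 : cs.length (v' * v⁻¹) = 0 := by omega
  rw [cs.length_eq_zero_iff] at h5
  rw [h5, mul_one] at h1
  exact ⟨h1, (mul_inv_eq_one.1 h5).symm⟩

theorem no_three (hM : Good M) (T : Finset (Fin n)) (hT : 3 ≤ T.card) (w : W)
    (h : ∀ i ∈ T, cs.IsRightDescent w i) : False := by
  have key : ∀ w : W, (∑ i ∈ T, al i) ≤ rho cs hM w (∑ i ∈ T, al i) := by
    intro w
    induction hN : cs.length w using Nat.strong_induction_on generalizing w with
    | _ N ih =>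
      by_cases hw : w = 1
      · subst hw; simp
      · obtain ⟨j, hj⟩ := cs.exists_rightDescent_of_ne_one hw
        have hl := cs.isRightDescent_iff.1 hj
        have h1 := ih _ (by omega) (w * cs.simple j) rfl
        have h2 := pos cs hM (w * cs.simple j) j
          (cs.isRightDescent_iff_not_isRightDescent_mul.1 hj)
        have h3 : w = w * cs.simple j * cs.simple j := by simp
        have h4 : pr M j (∑ i ∈ T, al i) ≤ 0 := by
          rw [map_sum]
          simp only [pr_al]
          by_cases hjT : j ∈ T
          · rw [← Finset.add_sum_erase T _ hjT, A_self]
            have h5 : ∑ x ∈ T.erase j, A M j x ≤ ∑ x ∈ T.erase j, (-1) :=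
              Finset.sum_le_sum fun x hx => A_le hM (Finset.ne_of_mem_erase hx).symm
            rw [Finset.sum_const, Finset.card_erase_of_mem hjT] at h5
            simp at h5
            omega
          · refine Finset.sum_nonpos fun x hx => ?_
            have := A_le hM (i := j) (j := x) (by rintro rfl; exact hjT hx)
            omega
        conv_rhs => rw [h3]
        rw [map_mul, Module.End.mul_apply, rho_simple, rf_apply, map_sub, map_smul]
        refine h1.trans ?_
        rw [le_sub_self_iff]
        exact smul_nonpos_of_nonpos_of_nonneg h4 h2
  have h1 := key w
  have h2 : rho cs hM w (∑ i ∈ T, al i) ≤ 0 := by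
    rw [map_sum]
    exact Finset.sum_nonpos fun i hi => neg_of_desc cs hM w i (h i hi)
  obtain ⟨i, hi⟩ : T.Nonempty := by
    rw [← Finset.card_pos]; omega
  have h3 := (h1.trans h2) i
  simp [al, Finset.sum_apply, Pi.single_apply, hi] at h3

theorem desc_alt (hM : Good M) {i j : Fin n} (hij : i ≠ j) (k : ℕ) (hk : M i j = 0 ∨ k < M i j) :
    ¬ cs.IsRightDescent (cs.wordProd (alternatingWord i j k)) i := by
  rw [not_desc_iff cs hM]
  obtain ⟨a, b, ha, hb, hab⟩ := rho_alt cs hM hij k hk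
  rw [hab]
  have : ∀ i : Fin n, (0 : Fin n → ℤ) ≤ al i := by intro i; simp [al]
  exact add_nonneg (smul_nonneg ha (this _)) (smul_nonneg hb (this _))

theorem length_alt (hM : Good M) {i j : Fin n} (hij : i ≠ j) (k : ℕ)
    (hk : M i j = 0 ∨ k ≤ M i j) :
    cs.length (cs.wordProd (alternatingWord i j k)) = k := by
  induction k generalizing i j with
  | zero => simp [alternatingWord]
  | succ k ih =>
    have hs := M.symmetric i j
    rw [alt_succ, cs.not_isRightDescent_iff.1 (desc_alt cs hM hij.symm k (by omega)),
      ih hij.symm (by omega)]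

theorem alt_mem {i j : Fin n} (T : Finset (Fin n)) (hi : i ∈ T) (hj : j ∈ T) (k : ℕ) :
    cs.wordProd (alternatingWord i j k) ∈ par cs T := by
  induction k generalizing i j with
  | zero => simpa [alternatingWord] using one_mem _
  | succ k ih =>
    rw [alt_succ]
    exact mul_mem (ih hj hi) (simple_mem_par cs hj)

theorem two_desc (hM : Good M) {i j : Fin n} (hij : i ≠ j) (w : W) :
    (w ∈ par cs {i, j} ∧ cs.IsRightDescent w i ∧ cs.IsRightDescent w j) ↔
      (M i j ≠ 0 ∧ w = cs.wordProd (alternatingWord i j (M i j))) := by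
  constructor
  · rintro ⟨hw, hi, hj⟩
    obtain ⟨k, v, hk, hwv, hl, hvi, hvj⟩ := decomp cs (i := i) w hj
    have ha := alt_mem cs (i := i) (j := j) {i, j} (by simp) (by simp) k
    have hv : v ∈ par cs {i, j} := by
      have : v = w * (cs.wordProd (alternatingWord i j k))⁻¹ := by rw [hwv]; simp
      rw [this]
      exact mul_mem hw (inv_mem ha)
    have hv1 : v = 1 := by
      apply par_eq_one cs hM _ v hv
      simp [hvi, hvj]
    subst hv1
    rw [one_mul] at hwv
    have hk0 : ¬ (M i j = 0 ∨ k < M i j) := by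
      intro hc
      apply desc_alt cs hM hij k hc
      rw [← hwv]; exact hi
    push Not at hk0
    refine ⟨hk0.1, ?_⟩
    have : k = M i j := by
      by_contra hne
      refine cs.not_isReduced_alternatingWord i j hk0.1 (m := k) (by omega) ?_
      rw [CoxeterSystem.IsReduced, length_alternatingWord, ← hwv, ← hl]; simp
    rw [← this]; exact hwv
  · rintro ⟨h0, rfl⟩
    refine ⟨alt_mem cs _ (by simp) (by simp) _, ?_, ?_⟩
    · rw [alt_m]
      obtain ⟨m, hm⟩ : ∃ m, M i j = m + 1 := ⟨M i j - 1, by omega⟩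
      rw [hm, alt_succ, ← cs.isRightDescent_iff_not_isRightDescent_mul.not_left] 
      exact desc_alt cs hM hij _ (by omega)
    · obtain ⟨m, hm⟩ : ∃ m, M i j = m + 1 := ⟨M i j - 1, by omega⟩
      rw [hm, alt_succ, ← cs.isRightDescent_iff_not_isRightDescent_mul.not_left] 
      have hs := M.symmetric i j
      exact desc_alt cs hM hij.symm _ (by omega)

theorem one_desc (hM : Good M) {i : Fin n} (w : W) :
    (w ∈ par cs {i} ∧ cs.IsRightDescent w i) ↔ w = cs.simple i := by
  constructor
  · rintro ⟨hw, hi⟩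
    have h1 : w * cs.simple i = 1 := by
      apply par_eq_one cs hM {i} _ (mul_mem hw (simple_mem_par cs (by simp)))
      simpa using cs.isRightDescent_iff_not_isRightDescent_mul.1 hi
    have h2 : w = w * cs.simple i * cs.simple i := by simp
    rw [h2, h1, one_mul]
  · rintro rfl
    exact ⟨simple_mem_par cs (by simp), by simp [IsRightDescent]⟩

open Classical in
/-- sphere -/
noncomputable def sph (k : ℕ) : Finset W :=
  Set.Finite.toFinset (s := {w : W | cs.length w = k}) (by
    refine ((List.finite_length_eq (Fin n) k).image cs.wordProd).subset ?_
    intro w hw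
    obtain ⟨l, hl, rfl⟩ := cs.exists_isReduced w
    exact ⟨l, by rw [← hw]; exact hl.symm, rfl⟩)

theorem mem_sph {k : ℕ} {w : W} : w ∈ sph cs k ↔ cs.length w = k := by
  simp [sph]

open Classical in
/-- generating series of a predicate -/
noncomputable def gs (p : W → Prop) : PowerSeries ℤ :=
  PowerSeries.mk fun k => ∑ w ∈ sph cs k, if p w then (1 : ℤ) else 0

open Classical in
theorem coeff_gs (p : W → Prop) (k : ℕ) :
    PowerSeries.coeff k (gs cs p) = (((sph cs k).filter p).card : ℤ) := by
  rw [gs, PowerSeries.coeff_mk, Finset.sum_boole]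

theorem gs_congr {p q : W → Prop} (h : ∀ w, p w ↔ q w) : gs cs p = gs cs q := by
  have : p = q := funext fun w => propext (h w)
  rw [this]

theorem gs_false {p : W → Prop} (h : ∀ w, ¬ p w) : gs cs p = 0 := by
  ext k
  simp [gs, h]

theorem gs_eq (w₀ : W) : gs cs (fun w => w = w₀) = (PowerSeries.X : PowerSeries ℤ) ^ cs.length w₀ := by
  classical
  ext k
  rw [gs, PowerSeries.coeff_mk, PowerSeries.coeff_X_pow, Finset.sum_ite_eq']
  simp only [mem_sph, eq_comm]

/-- Poincare series of a parabolic subgroup -/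
noncomputable def Ps (T : Finset (Fin n)) : PowerSeries ℤ := gs cs (fun w => w ∈ par cs T)

theorem const_Ps (T : Finset (Fin n)) : PowerSeries.constantCoeff (Ps cs T) = 1 := by
  classical
  rw [← PowerSeries.coeff_zero_eq_constantCoeff_apply]
  have : sph cs 0 = {1} := by
    ext w; simp [mem_sph]
  rw [Ps, gs, PowerSeries.coeff_mk, this, Finset.sum_singleton, if_pos (one_mem _)]

theorem Ps_mul (hM : Good M) {T U : Finset (Fin n)} (hTU : T ⊆ U) :
    Ps cs U = gs cs (fun w => w ∈ par cs U ∧ ∀ i ∈ T, ¬ cs.IsRightDescent w i) * Ps cs T := by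
  classical
  ext k
  rw [PowerSeries.coeff_mul]
  simp only [Ps, coeff_gs, ← Nat.cast_mul, ← Finset.card_product,
    ← Nat.cast_sum, ← Finset.card_sigma]
  congr 1
  symm
  refine Finset.card_bij (fun x _ => x.2.1 * x.2.2) ?_ ?_ ?_
  · rintro ⟨⟨a, b⟩, u, v⟩ h
    simp only [Finset.mem_sigma, Finset.mem_product, Finset.mem_filter,
      mem_sph] at h ⊢
    obtain ⟨h1, ⟨h2, h3, h4⟩, h5, h6⟩ := h
    refine ⟨?_, mul_mem h3 (par_mono cs hTU h6)⟩
    have h1 : a + b = k := Finset.HasAntidiagonal.mem_antidiagonal.1 h1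
    rw [add_length cs hM T u v h4 h6]
    omega
  · rintro ⟨⟨a, b⟩, u, v⟩ h ⟨⟨a', b'⟩, u', v'⟩ h' heq
    simp only [Finset.mem_sigma, Finset.mem_product, Finset.mem_filter,
      mem_sph] at h h' heq
    obtain ⟨h1, ⟨h2, h3, h4⟩, h5, h6⟩ := h
    obtain ⟨h1', ⟨h2', h3', h4'⟩, h5', h6'⟩ := h'
    obtain ⟨rfl, rfl⟩ := fact_unique cs hM T u v u' v' h4 h6 h4' h6' heq
    subst h2 h5 h2' h5'
    rfl
  · intro w hw
    simp only [Finset.mem_filter, mem_sph] at hw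
    obtain ⟨u, v, h1, h2, h3⟩ := exists_fact cs T w
    have hu : u ∈ par cs U := by
      have : u = w * v⁻¹ := by rw [h1]; simp
      rw [this]
      exact mul_mem hw.2 (inv_mem (par_mono cs hTU h2))
    refine ⟨⟨(cs.length u, cs.length v), u, v⟩, ?_, h1.symm⟩
    simp only [Finset.mem_sigma, Finset.mem_product, Finset.mem_filter, mem_sph]
    refine ⟨Finset.HasAntidiagonal.mem_antidiagonal.2 ?_, ⟨trivial, hu, h3⟩, trivial, h2⟩
    change cs.length u + cs.length v = k
    rw [← add_length cs hM T u v h3 h2, ← h1, hw.1]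

/-- inverse series -/
noncomputable def Qs (T : Finset (Fin n)) : PowerSeries ℤ := PowerSeries.invOfUnit (Ps cs T) 1

theorem Ps_Qs (T : Finset (Fin n)) : Ps cs T * Qs cs T = 1 :=
  PowerSeries.mul_invOfUnit _ _ (by rw [const_Ps]; rfl)

/-- Moebius transform -/
noncomputable def Zs (U : Finset (Fin n)) : PowerSeries ℤ :=
  ∑ T ∈ U.powerset, (-1) ^ T.card * Qs cs T

theorem Ps_Zs (hM : Good M) (U : Finset (Fin n)) :
    Ps cs U * Zs cs U = gs cs (fun w => w ∈ par cs U ∧ ∀ i ∈ U, cs.IsRightDescent w i) := by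
  classical
  have h1 : Ps cs U * Zs cs U = ∑ T ∈ U.powerset, (-1) ^ T.card *
      gs cs (fun w => w ∈ par cs U ∧ ∀ i ∈ T, ¬ cs.IsRightDescent w i) := by
    rw [Zs, Finset.mul_sum]
    refine Finset.sum_congr rfl fun T hT => ?_
    rw [Ps_mul cs hM (Finset.mem_powerset.1 hT)]
    linear_combination ((-1) ^ T.card *
      gs cs (fun w => w ∈ par cs U ∧ ∀ i ∈ T, ¬ cs.IsRightDescent w i)) * Ps_Qs cs T
  rw [h1]
  ext k
  have hc : ∀ (m : ℕ) (f : PowerSeries ℤ), PowerSeries.coeff k ((-1) ^ m * f) =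
      (-1) ^ m * PowerSeries.coeff k f := by
    intro m f
    rcases neg_one_pow_eq_or (PowerSeries ℤ) m with h | h <;>
    rcases Nat.even_or_odd m with h' | h' <;> simp [h'.neg_one_pow]
  simp only [map_sum, hc, gs, PowerSeries.coeff_mk, Finset.mul_sum]
  rw [Finset.sum_comm]
  refine Finset.sum_congr rfl fun w _ => ?_
  by_cases hw : w ∈ par cs U
  · simp only [hw, true_and]
    have h2 := Finset.sum_powerset_neg_one_pow_card (x := U.filter fun i => ¬ cs.IsRightDescent w i)
    have h3 : (U.filter fun i => ¬ cs.IsRightDescent w i).powerset =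
        U.powerset.filter fun T => ∀ i ∈ T, ¬ cs.IsRightDescent w i := by
      ext T
      simp only [Finset.mem_powerset, Finset.mem_filter, Finset.subset_iff]
      exact ⟨fun h => ⟨fun i hi => (h hi).1, fun i hi => (h hi).2⟩,
        fun h i hi => ⟨h.1 hi, h.2 i hi⟩⟩
    rw [h3, Finset.sum_filter] at h2
    simp only [mul_ite, mul_one, mul_zero]
    rw [h2]
    congr 1
    simp [Finset.filter_eq_empty_iff]
  · simp [hw]

theorem Zs_eq (hM : Good M) (U : Finset (Fin n)) :
    Zs cs U = Qs cs U *
      gs cs (fun w => w ∈ par cs U ∧ ∀ i ∈ U, cs.IsRightDescent w i) := by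
  rw [← Ps_Zs cs hM]
  linear_combination (-Zs cs U) * Ps_Qs cs U

theorem Zs_big (hM : Good M) (U : Finset (Fin n)) (h : 3 ≤ U.card) : Zs cs U = 0 := by
  rw [Zs_eq cs hM, gs_false cs (fun w hw => no_three cs hM U h w hw.2), mul_zero]

theorem mobius {R : Type*} [CommRing R] {B : Type*} [DecidableEq B] (Q : Finset B → R)
    (S : Finset B) :
    Q S = ∑ V ∈ S.powerset, (-1) ^ V.card * ∑ T ∈ V.powerset, (-1) ^ T.card * Q T := by
  induction S using Finset.induction_on generalizing Q with
  | empty => simp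
  | insert a S ha ih =>
    have key : ∀ f : Finset B → R, ∑ V ∈ (insert a S).powerset, f V =
        ∑ V ∈ S.powerset, f V + ∑ V ∈ S.powerset, f (insert a V) :=
      fun f => Finset.sum_powerset_insert ha f
    have h2 := ih (fun T => Q (insert a T))
    rw [key, ← ih Q]
    have h3 : ∀ V ∈ S.powerset, (-1) ^ (insert a V).card *
        ∑ T ∈ (insert a V).powerset, (-1) ^ T.card * Q T =
        (-1) ^ V.card * ∑ T ∈ V.powerset, (-1) ^ T.card * Q (insert a T)
        - (-1) ^ V.card * ∑ T ∈ V.powerset, (-1) ^ T.card * Q T := by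
      intro V hV
      have haV : a ∉ V := fun h => ha (Finset.mem_powerset.1 hV h)
      rw [Finset.sum_powerset_insert haV, Finset.card_insert_of_notMem haV]
      have : ∑ T ∈ V.powerset, (-1) ^ (insert a T).card * Q (insert a T) =
          - ∑ T ∈ V.powerset, (-1) ^ T.card * Q (insert a T) := by
        rw [← Finset.sum_neg_distrib]
        refine Finset.sum_congr rfl fun T hT => ?_
        rw [Finset.card_insert_of_notMem fun h => haV (Finset.mem_powerset.1 hT h)]
        ring
      rw [this]
      ring
    rw [Finset.sum_congr rfl h3, Finset.sum_sub_distrib, ← h2, ← ih Q]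
    ring

/-- universal series -/
noncomputable def q1 : PowerSeries ℤ := PowerSeries.invOfUnit (1 + PowerSeries.X) 1

/-- universal series -/
noncomputable def dm (m : ℕ) : PowerSeries ℤ := if m = 0 then 0 else PowerSeries.X ^ m

/-- universal series -/
noncomputable def ym (m : ℕ) : PowerSeries ℤ :=
  PowerSeries.invOfUnit (1 - dm m) 1 * (2 * q1 - 1) * dm m

theorem Ps_empty : Ps cs ∅ = 1 := by
  have : gs cs (fun w => w ∈ par cs ∅) = gs cs (fun w => w = 1) :=
    gs_congr cs fun w => by simp [par]
  rw [Ps, this, gs_eq]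
  simp

theorem Qs_empty : Qs cs ∅ = 1 := by
  have := Ps_Qs cs ∅
  rwa [Ps_empty, one_mul] at this

theorem Zs_empty : Zs cs ∅ = 1 := by
  simp [Zs, Qs_empty]

theorem Zs_single' (i : Fin n) : Zs cs {i} = 1 - Qs cs {i} := by
  have : ({i} : Finset (Fin n)).powerset = {∅, {i}} := by
    ext T; simp [Finset.subset_singleton_iff]
  rw [Zs, this, Finset.sum_pair (by simp [eq_comm])]
  simp [Qs_empty, sub_eq_add_neg]

theorem Qs_single (hM : Good M) (i : Fin n) : Qs cs {i} = q1 := by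
  have h1 := Zs_eq cs hM {i}
  rw [Zs_single', gs_congr cs (q := fun w => w = cs.simple i)
    (fun w => by rw [← one_desc cs hM w]; simp), gs_eq, cs.length_simple, pow_one] at h1
  have h2 : (1 + PowerSeries.X) * q1 = 1 := PowerSeries.mul_invOfUnit _ _ (by simp)
  linear_combination (-q1) * h1 - Qs cs {i} * h2

theorem Zs_pair' (i j : Fin n) (hij : i ≠ j) :
    Zs cs {i, j} = 1 - Qs cs {i} - Qs cs {j} + Qs cs {i, j} := by
  have h := Finset.sum_powerset_insert (s := {j}) (a := i) (by simpa using hij)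
    (fun T => (-1) ^ T.card * Qs cs T)
  have : ({j} : Finset (Fin n)).powerset = {∅, {j}} := by
    ext T; simp [Finset.subset_singleton_iff]
  rw [Zs, h, this, Finset.sum_pair (by simp [eq_comm]), Finset.sum_pair (by simp [eq_comm])]
  simp [Qs_empty, Finset.card_pair hij]
  ring

theorem Zs_pair (hM : Good M) {i j : Fin n} (hij : i ≠ j) : Zs cs {i, j} = ym (M i j) := by
  have h1 := Zs_eq cs hM {i, j}
  have hd : gs cs (fun w => w ∈ par cs {i, j} ∧ ∀ k ∈ ({i, j} : Finset (Fin n)),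
      cs.IsRightDescent w k) = dm (M i j) := by
    by_cases h0 : M i j = 0
    · rw [dm, if_pos h0]
      refine gs_false cs fun w hw => ?_
      simp only [Finset.mem_insert, Finset.mem_singleton, forall_eq_or_imp, forall_eq] at hw
      exact ((two_desc cs hM hij w).1 hw).1 h0
    · rw [dm, if_neg h0]
      rw [gs_congr cs (q := fun w => w = cs.wordProd (alternatingWord i j (M i j)))]
      · rw [gs_eq, length_alt cs hM hij _ (Or.inr le_rfl)]
      · intro w
        have := two_desc cs hM hij w
        simp only [Finset.mem_insert, Finset.mem_singleton, forall_eq_or_imp, forall_eq]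
        rw [this]
        simp [h0]
  rw [hd] at h1
  have h2 := h1
  rw [Zs_pair' cs i j hij, Qs_single cs hM, Qs_single cs hM] at h2
  have h3 : (1 - dm (M i j)) * PowerSeries.invOfUnit (1 - dm (M i j)) 1 = 1 := by
    refine PowerSeries.mul_invOfUnit _ _ ?_
    rw [dm]
    split_ifs with h <;> simp [h]
  rw [h1, ym]
  linear_combination (PowerSeries.invOfUnit (1 - dm (M i j)) 1 * dm (M i j)) * h2 -
    (Qs cs {i, j} * dm (M i j)) * h3

/-- label of a pair -/
def lab (M : CoxeterMatrix (Fin n)) (V : Finset (Fin n)) : ℕ :=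
  V.sup fun i => (V.erase i).sup (M i)

theorem lab_pair {i j : Fin n} (hij : i ≠ j) : lab M {i, j} = M i j := by
  have h1 : ({i, j} : Finset (Fin n)).erase i = {j} := by
    ext k; simp; grind
  have h2 : ({i, j} : Finset (Fin n)).erase j = {i} := by
    ext k; simp; grind
  simp [lab, h1, h2, M.symmetric j i]

/-- universal function -/
noncomputable def Gf (n : ℕ) (s : Multiset ℕ) : PowerSeries ℤ :=
  PowerSeries.invOfUnit (1 - n * (1 - q1) + (s.map ym).sum) 1

theorem Ps_univ (hM : Good M) :
    Ps cs Finset.univ = Gf n ((Finset.powersetCard 2 (Finset.univ : Finset (Fin n))).val.map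
      (lab M)) := by
  have h1 : Qs cs Finset.univ = 1 - n * (1 - q1) +
      (((Finset.powersetCard 2 (Finset.univ : Finset (Fin n))).val.map (lab M)).map ym).sum := by
    rw [mobius (Qs cs) Finset.univ]
    have hz : ∀ V ∈ (Finset.univ : Finset (Fin n)).powerset, (-1) ^ V.card * Zs cs V =
        (if V.card = 0 then 1 else 0) - (if V.card = 1 then (1 - q1) else 0) +
          (if V.card = 2 then ym (lab M V) else 0) := by
      intro V _
      rcases Nat.lt_or_ge V.card 3 with h | h
      · interval_cases hV : V.card
        · rw [Finset.card_eq_zero] at hV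
          subst hV
          simp [Zs_empty]
        · obtain ⟨i, rfl⟩ := Finset.card_eq_one.1 hV
          simp [Zs_single', Qs_single cs hM]
        · obtain ⟨i, j, hij, rfl⟩ := Finset.card_eq_two.1 hV
          simp [Zs_pair cs hM hij, lab_pair hij]
      · rw [Zs_big cs hM V h, if_neg (by omega), if_neg (by omega), if_neg (by omega)]
        simp
    change ∑ V ∈ (Finset.univ : Finset (Fin n)).powerset, (-1) ^ V.card * Zs cs V = _
    rw [Finset.sum_congr rfl hz, Finset.sum_add_distrib, Finset.sum_sub_distrib,
      ← Finset.sum_filter, ← Finset.sum_filter, ← Finset.sum_filter,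
      ← Finset.powersetCard_eq_filter, ← Finset.powersetCard_eq_filter,
      ← Finset.powersetCard_eq_filter, Multiset.map_map]
    simp only [Finset.sum_const, Finset.card_powersetCard, Finset.card_univ, Fintype.card_fin]
    rw [Nat.choose_zero_right, Nat.choose_one_right, one_smul, nsmul_eq_mul]
    rfl
  have h2 := Ps_Qs cs Finset.univ
  rw [Gf, ← h1]
  have h3 : Qs cs Finset.univ * PowerSeries.invOfUnit (Qs cs Finset.univ) 1 = 1 := by
    refine PowerSeries.mul_invOfUnit _ _ ?_
    have := congrArg PowerSeries.constantCoeff h2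
    rw [map_mul, const_Ps, one_mul, map_one] at this
    rw [this]; rfl
  exact left_inv_eq_right_inv h2 h3

end Main

theorem cox_eq (M : CoxeterMatrix (Fin n)) :
    coxPoincare M = Ps M.toCoxeterSystem Finset.univ := by
  ext k
  simp only [coxPoincare, Ps, gs, PowerSeries.coeff_mk, par_univ, Subgroup.mem_top, if_true,
    Finset.sum_const]
  simp only [nsmul_eq_mul, mul_one, Nat.cast_inj]
  rw [Nat.subtype_card (sph M.toCoxeterSystem k)]
  intro w
  exact mem_sph _

end CoxP

/-- for `n ≥ 1`, the set of Poincaré series of Coxeter matrices on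
`{1, …, n}` with all off-diagonal entries in `{3, 4, 6, ∞}` (with `∞` encoded as `0`)
is finite of cardinality at most `C(n(n−1)/2 + 3, 3)`. -/
theorem poincare_set_finite_card_le (n : ℕ) (hn : 1 ≤ n) :
    {P : PowerSeries ℤ | ∃ M : CoxeterMatrix (Fin n),
        (∀ i j : Fin n, i ≠ j → M i j = 3 ∨ M i j = 4 ∨ M i j = 6 ∨ M i j = 0) ∧
        P = coxPoincare M}.Finite ∧
    {P : PowerSeries ℤ | ∃ M : CoxeterMatrix (Fin n),
        (∀ i j : Fin n, i ≠ j → M i j = 3 ∨ M i j = 4 ∨ M i j = 6 ∨ M i j = 0) ∧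
        P = coxPoincare M}.ncard ≤ Nat.choose (n * (n - 1) / 2 + 3) 3 := by
  classical
  set S := {P : PowerSeries ℤ | ∃ M : CoxeterMatrix (Fin n),
        (∀ i j : Fin n, i ≠ j → M i j = 3 ∨ M i j = 4 ∨ M i j = 6 ∨ M i j = 0) ∧
        P = coxPoincare M} with hS
  let g : Fin 4 → ℕ := ![0, 3, 4, 6]
  let F : Sym (Fin 4) (n.choose 2) → PowerSeries ℤ := fun s =>
    CoxP.Gf n (s.1.map g)
  have hsub : S ⊆ Set.range F := by
    rintro P ⟨M, hM, rfl⟩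
    rw [CoxP.cox_eq, CoxP.Ps_univ _ hM]
    let lb : Finset (Fin n) → Fin 4 := fun V =>
      if CoxP.lab M V = 3 then 1 else if CoxP.lab M V = 4 then 2 else
        if CoxP.lab M V = 6 then 3 else 0
    refine ⟨⟨(Finset.powersetCard 2 (Finset.univ : Finset (Fin n))).val.map lb, by simp⟩, ?_⟩
    simp only [F, Multiset.map_map]
    congr 1
    refine Multiset.map_congr rfl fun V hV => ?_
    have hV : V ∈ Finset.powersetCard 2 (Finset.univ : Finset (Fin n)) := hV
    rw [Finset.mem_powersetCard] at hV
    obtain ⟨i, j, hij, rfl⟩ := Finset.card_eq_two.1 hV.2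
    have := CoxP.lab_pair (M := M) hij
    rcases hM i j hij with h | h | h | h <;> simp [lb, g, this, h]
  have hfin : (Set.range F).Finite := Set.finite_range F
  refine ⟨hfin.subset hsub, (Set.ncard_le_ncard hsub hfin).trans ?_⟩
  rw [← Set.image_univ]
  refine (Set.ncard_image_le Set.finite_univ).trans ?_
  rw [Set.ncard_univ, Nat.card_eq_fintype_card, Sym.card_sym_eq_choose, Fintype.card_fin,
    Nat.choose_two_right, Nat.choose_symm_of_eq_add (show 4 + n * (n - 1) / 2 - 1 =
      n * (n - 1) / 2 + 3 by omega)]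
  exact le_of_eq (by congr 1; omega)
end

section
/- Let A be an n×n generalized Cartan matrix whose Weyl group W(A) is infinite. For each I ⊆ S = {1,…,n} with W_I(A) finite, the Poincaré series P_I(A) is a polynomial with constant term 1. Let L ∈ ℤ[t] be the least common multiple, normalized to have constant term 1, of the polynomials {P_I(A) : I ⊆ S, W_I(A) finite}. Then there exists a polynomial R ∈ ℤ[t] such that R · P(A) = L in ℤ⟦t⟧; that is, P(A) is a rational function whose numerator can be taken to be L. -/
open PowerSeries

/-- `A` is a generalized Cartan matrix. -/
structure IsGCM {n : ℕ} (A : Matrix (Fin n) (Fin n) ℤ) : Prop where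
  diag : ∀ i, A i i = 2
  nonpos : ∀ i j, i ≠ j → A i j ≤ 0
  zero_symm : ∀ i j, A i j = 0 → A j i = 0

/-- The Coxeter matrix entry associated to the product `aᵢⱼ·aⱼᵢ`:
it is `2, 3, 4, 6, ∞` according as the product is `0, 1, 2, 3, ≥ 4`
(`0` encodes `∞`, as in Mathlib's convention for `CoxeterMatrix`). -/
def gcmEntry (p : ℤ) : ℕ :=
  if p = 0 then 2 else if p = 1 then 3 else if p = 2 then 4 else if p = 3 then 6 else 0

/-- The Coxeter matrix of a generalized Cartan matrix. -/
def gcmCoxeter {n : ℕ} (A : Matrix (Fin n) (Fin n) ℤ) : CoxeterMatrix (Fin n) where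
  M := Matrix.of fun i j => if i = j then 1 else gcmEntry (A i j * A j i)
  isSymm := by
    ext i j
    simp only [Matrix.transpose_apply, Matrix.of_apply]
    rcases eq_or_ne i j with h | h
    · simp [h]
    · rw [if_neg h.symm, if_neg h, mul_comm]
  diagonal i := by simp
  off_diagonal i j h := by
    rw [Matrix.of_apply, if_neg h]
    unfold gcmEntry
    split_ifs <;> omega

/-- The Poincaré series of the standard parabolic subgroup `W_I` of the Coxeter group of
`M` generated by the simple reflections indexed by `I` (the length being computed in the
full Coxeter group, which agrees with the length in `W_I`). -/
noncomputable def coxSubPoincare {B : Type*} (M : CoxeterMatrix B) (I : Set B) :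
    PowerSeries ℤ :=
  PowerSeries.mk fun k =>
    (Nat.card {w : M.Group // w ∈ Subgroup.closure (M.toCoxeterSystem.simple '' I) ∧
        M.toCoxeterSystem.length w = k} : ℤ)

namespace PNL
open CoxeterSystem List

variable {B W : Type*} [Group W] {M : CoxeterMatrix B} (cs : CoxeterSystem M W)

open Classical in
/-- the reflection action -/
noncomputable def act (i : B) : Function.End (W × ZMod 2) :=
  fun p => (cs.simple i * p.1 * cs.simple i, p.2 + if p.1 = cs.simple i then 1 else 0)

lemma end_mul {α : Type*} (f g : Function.End α) (x : α) : (f * g) x = f (g x) := rfl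

lemma conj_eq_iff {G : Type*} [Group G] (a t x : G) : a * t * a⁻¹ = x ↔ t = a⁻¹ * x * a := by
  constructor
  · rintro rfl; group
  · rintro rfl; group

open Classical in
lemma act_pow (i j : B) (k : ℕ) (t : W) (e : ZMod 2) :
    ((act cs i * act cs j) ^ k) (t, e) =
      ((cs.simple i * cs.simple j) ^ k * t * ((cs.simple i * cs.simple j) ^ k)⁻¹,
        e + ∑ r ∈ Finset.range (2 * k),
          if t = cs.simple j * (cs.simple i * cs.simple j) ^ r then 1 else 0) := by
  induction k with
  | zero => simp [Function.End.one_def]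
  | succ k ih =>
    rw [pow_succ', end_mul, ih]
    have hc : ∀ r : ℕ, cs.simple j * (cs.simple i * cs.simple j) ^ r =
        ((cs.simple i * cs.simple j) ^ r)⁻¹ * cs.simple j := by
      intro r
      induction r with
      | zero => simp
      | succ r ihr =>
        rw [pow_succ, ← mul_assoc, ihr, mul_inv_rev, mul_assoc, mul_assoc]
        have : cs.simple j * (cs.simple i * cs.simple j) =
          (cs.simple i * cs.simple j)⁻¹ * cs.simple j := by simp [mul_assoc]
        rw [this, ← mul_assoc, ← mul_assoc, ← mul_inv_rev, ← mul_inv_rev, ← pow_succ, ← pow_succ']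
    rw [end_mul]
    simp only [act]
    rw [show 2 * (k + 1) = 2 * k + 1 + 1 by ring, Finset.sum_range_succ, Finset.sum_range_succ]
    have h1 : ((cs.simple i * cs.simple j) ^ k * t * ((cs.simple i * cs.simple j) ^ k)⁻¹
        = cs.simple j) ↔ t = cs.simple j * (cs.simple i * cs.simple j) ^ (2 * k) := by
      rw [two_mul, pow_add, ← mul_assoc, hc]
      exact conj_eq_iff _ _ _
    have h2 : (cs.simple j * ((cs.simple i * cs.simple j) ^ k * t *
        ((cs.simple i * cs.simple j) ^ k)⁻¹) * cs.simple j
        = cs.simple i) ↔ t = cs.simple j * (cs.simple i * cs.simple j) ^ (2 * k + 1) := by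
      have e1 : cs.simple j * (cs.simple i * cs.simple j) ^ (2 * k + 1) =
          ((cs.simple i * cs.simple j) ^ k)⁻¹ * (cs.simple j * cs.simple i * cs.simple j) *
            (cs.simple i * cs.simple j) ^ k := by
        rw [show 2 * k + 1 = k + (1 + k) by ring, pow_add, ← mul_assoc, hc, pow_add, pow_one]
        simp only [mul_assoc]
      rw [e1, ← conj_eq_iff]
      generalize (cs.simple i * cs.simple j) ^ k * t * ((cs.simple i * cs.simple j) ^ k)⁻¹ = x
      constructor
      · intro h; rw [← h]; simp [mul_assoc]
      · rintro rfl; simp [mul_assoc]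
    simp only [h1, h2]
    refine Prod.ext ?_ ?_
    · simp [pow_succ', mul_assoc]
    · simp [add_assoc]

lemma act_liftable : M.IsLiftable (act cs) := by
  intro i j
  funext ⟨t, e⟩
  have hm := cs.simple_mul_simple_pow i j
  generalize M.M i j = m at hm ⊢
  rw [act_pow, hm]
  change _ = (t, e)
  refine Prod.ext (by simp) ?_
  change e + _ = e
  have hx : ∀ x : ℕ, (cs.simple i * cs.simple j) ^ (m + x) = (cs.simple i * cs.simple j) ^ x := by
    intro x; rw [pow_add, hm, one_mul]
  have hf : ∀ f : ℕ → ZMod 2, (∀ x, f (m + x) = f x) → ∑ x ∈ Finset.range (2 * m), f x = 0 := by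
    intro f hf
    rw [two_mul, Finset.sum_range_add]
    simp only [hf]
    exact CharTwo.add_self_eq_zero _
  rw [hf _ (fun x => by rw [hx]), add_zero]

open Classical in
lemma lift_act (ω : List B) (t : W) (e : ZMod 2) :
    cs.lift ⟨act cs, act_liftable cs⟩ (cs.wordProd ω) (t, e) =
      (cs.wordProd ω * t * (cs.wordProd ω)⁻¹, e + ((cs.rightInvSeq ω).count t : ZMod 2)) := by
  induction ω with
  | nil => simp [Function.End.one_def]
  | cons i ω ih =>
    rw [cs.wordProd_cons, map_mul, end_mul, ih,
      cs.lift_apply_simple]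
    simp only [act, rightInvSeq, List.count_cons]
    refine Prod.ext (by simp [mul_assoc]) ?_
    have : (cs.wordProd ω * t * (cs.wordProd ω)⁻¹ = cs.simple i) ↔
      (cs.wordProd ω)⁻¹ * cs.simple i * cs.wordProd ω = t := by
      constructor
      · intro h; rw [← h]; group
      · rintro rfl; group
    simp [this, add_assoc]

lemma exchange (ω : List B) (i : B)
    (h : cs.length (cs.wordProd ω * cs.simple i) < cs.length (cs.wordProd ω)) :
    ∃ j < ω.length, cs.wordProd ω * cs.simple i = cs.wordProd (ω.eraseIdx j) := by
  classical
  obtain ⟨ω', hr, hω'⟩ := cs.exists_isReduced (cs.wordProd ω * cs.simple i)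
  have hp : cs.wordProd (ω'.concat i) = cs.wordProd ω := by
    rw [cs.wordProd_concat, ← hω']; simp
  have hred : cs.IsReduced (ω'.concat i) := by
    unfold CoxeterSystem.IsReduced
    rw [hp]
    have h1 := cs.length_mul_simple (cs.wordProd ω) i
    have h2 := hr.eq
    rw [← hω'] at h2
    simp
    omega
  have hc : (cs.rightInvSeq (ω'.concat i)).count (cs.simple i) = 1 := by
    apply List.count_eq_one_of_mem hred.nodup_rightInvSeq
    rw [cs.rightInvSeq_concat]; simp
  have key := congrArg (fun w => (cs.lift ⟨act cs, act_liftable cs⟩ w (cs.simple i, 0)).2) hp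
  simp only [lift_act, hc, zero_add] at key
  have hmem : cs.simple i ∈ cs.rightInvSeq ω := by
    by_contra hn
    rw [List.count_eq_zero_of_not_mem hn] at key
    simp at key
  obtain ⟨j, hj, hjs⟩ := List.mem_iff_getElem.mp hmem
  refine ⟨j, by simpa using hj, ?_⟩
  rw [← cs.wordProd_mul_getD_rightInvSeq, List.getD_eq_getElem _ _ hj, hjs]

lemma exch2 (u v : W) (i : B) (h : cs.length (u * v * cs.simple i) < cs.length (u * v)) :
    cs.length (u * (v * cs.simple i * v⁻¹)) < cs.length u ∨
      cs.length (v * cs.simple i) < cs.length v := by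
  obtain ⟨a, ha, rfl⟩ := cs.exists_isReduced u
  obtain ⟨b, hb, rfl⟩ := cs.exists_isReduced v
  rw [← cs.wordProd_append] at h
  obtain ⟨j, hj, he⟩ := exchange cs _ _ h
  rw [List.length_append] at hj
  by_cases hja : j < a.length
  · left
    rw [List.eraseIdx_append_of_lt_length hja, cs.wordProd_append, cs.wordProd_append] at he
    rw [← mul_assoc, ← mul_assoc, he, mul_inv_cancel_right, ha.eq]
    refine lt_of_le_of_lt (cs.length_wordProd_le _) ?_
    rw [List.length_eraseIdx_of_lt hja]; omega
  · right
    push Not at hja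
    rw [List.eraseIdx_append_of_length_le hja, cs.wordProd_append, cs.wordProd_append,
      mul_assoc, mul_right_inj] at he
    rw [he, hb.eq]
    refine lt_of_le_of_lt (cs.length_wordProd_le _) ?_
    rw [List.length_eraseIdx_of_lt (by omega)]; omega

/-- parabolic -/
abbrev par (J : Set B) : Subgroup W := Subgroup.closure (cs.simple '' J)

lemma par_ind (J : Set B) {P : W → Prop} (h1 : P 1)
    (hs : ∀ w ∈ par cs J, ∀ i ∈ J, P w → P (w * cs.simple i)) (w : W) (hw : w ∈ par cs J) :
    P w := by
  induction hw using Subgroup.closure_induction_right with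
  | one => exact h1
  | mul_right x hx y hy ih =>
    obtain ⟨i, hi, rfl⟩ := hy
    exact hs x hx i hi ih
  | mul_inv_cancel x hx y hy ih =>
    obtain ⟨i, hi, rfl⟩ := hy
    rw [cs.inv_simple]
    exact hs x hx i hi ih

lemma simple_mem (J : Set B) {i : B} (hi : i ∈ J) : cs.simple i ∈ par cs J :=
  Subgroup.subset_closure ⟨i, hi, rfl⟩

lemma par_reduced (J : Set B) (w : W) (hw : w ∈ par cs J) :
    ∃ ω : List B, (∀ i ∈ ω, i ∈ J) ∧ cs.IsReduced ω ∧ cs.wordProd ω = w := by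
  refine par_ind cs J (P := fun w => ∃ ω : List B, (∀ i ∈ ω, i ∈ J) ∧ cs.IsReduced ω ∧
    cs.wordProd ω = w) ⟨[], by simp, by simp [CoxeterSystem.IsReduced], by simp⟩ ?_ w hw
  rintro _ - i hi ⟨ω, hJ, hr, rfl⟩
  have hl := cs.length_mul_simple (cs.wordProd ω) i
  by_cases h : cs.length (cs.wordProd ω * cs.simple i) < cs.length (cs.wordProd ω)
  · obtain ⟨j, hj, he⟩ := exchange cs _ _ h
    refine ⟨ω.eraseIdx j, fun i hi => hJ i (List.mem_of_mem_eraseIdx hi), ?_, he.symm⟩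
    unfold CoxeterSystem.IsReduced
    rw [← he, List.length_eraseIdx_of_lt hj]
    have := hr.eq
    omega
  · refine ⟨ω.concat i, ?_, ?_, cs.wordProd_concat _ _⟩
    · intro k hk
      simp at hk
      rcases hk with hk | rfl
      exacts [hJ k hk, hi]
    · unfold CoxeterSystem.IsReduced
      rw [cs.wordProd_concat]
      have := hr.eq
      simp
      omega

lemma par_descent (J : Set B) (w : W) (hw : w ∈ par cs J) (h1 : w ≠ 1) :
    ∃ i ∈ J, cs.IsRightDescent w i := by
  obtain ⟨ω, hJ, hr, rfl⟩ := par_reduced cs J w hw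
  rcases List.eq_nil_or_concat ω with rfl | ⟨L, b, rfl⟩
  · simp at h1
  · refine ⟨b, hJ b (by simp), ?_⟩
    unfold IsRightDescent
    rw [hr.eq, cs.wordProd_concat, cs.simple_mul_simple_cancel_right]
    exact cs.length_wordProd_le _ |>.trans_lt (by simp)

/-- no descents in `J` -/
def NoDesc (J : Set B) (u : W) : Prop := ∀ i ∈ J, ¬ cs.IsRightDescent u i

lemma length_of_min (J : Set B) (u : W)
    (hmin : ∀ x ∈ par cs J, cs.length u ≤ cs.length (u * x)) (v : W) (hv : v ∈ par cs J) :
    cs.length (u * v) = cs.length u + cs.length v := by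
  refine par_ind cs J (P := fun v => cs.length (u * v) = cs.length u + cs.length v) (by simp) ?_
    v hv
  intro v hv i hi ih
  have h1 := cs.length_mul_simple v i
  have h2 := cs.length_mul_simple (u * v) i
  have h3 := cs.length_mul_le u (v * cs.simple i)
  rw [← mul_assoc] at h3 ⊢
  by_cases h : cs.length (u * v * cs.simple i) < cs.length (u * v)
  · rcases exch2 cs u v i h with h' | h'
    · have := hmin (v * cs.simple i * v⁻¹)
        (mul_mem (mul_mem hv (simple_mem cs J hi)) (inv_mem hv))
      omega
    · omega
  · omega

lemma exists_min (J : Set B) (w : W) :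
    ∃ u v, v ∈ par cs J ∧ w = u * v ∧ ∀ x ∈ par cs J, cs.length u ≤ cs.length (u * x) := by
  classical
  have hex : ∃ k, ∃ x ∈ par cs J, cs.length (w * x) = k := ⟨_, 1, one_mem _, rfl⟩
  obtain ⟨x, hx, hk⟩ := Nat.find_spec hex
  refine ⟨w * x, x⁻¹, inv_mem hx, by simp, fun y hy => ?_⟩
  rw [hk]
  exact Nat.find_min' hex ⟨x * y, mul_mem hx hy, by rw [mul_assoc]⟩

lemma noDesc_of_min (J : Set B) (u : W)
    (hmin : ∀ x ∈ par cs J, cs.length u ≤ cs.length (u * x)) : NoDesc cs J u :=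
  fun _ hi h => absurd h (not_lt.mpr (hmin _ (simple_mem cs J hi)))

lemma min_of_noDesc (J : Set B) (w : W) (h : NoDesc cs J w) :
    ∀ x ∈ par cs J, cs.length w ≤ cs.length (w * x) := by
  obtain ⟨u, v, hv, rfl, hmin⟩ := exists_min cs J w
  by_cases h1 : v = 1
  · subst h1; simpa using hmin
  · obtain ⟨i, hi, hd⟩ := par_descent cs J v hv h1
    exfalso
    apply h i hi
    unfold IsRightDescent at hd ⊢
    rw [mul_assoc, length_of_min cs J u hmin v hv,
      length_of_min cs J u hmin _ (mul_mem hv (simple_mem cs J hi))]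
    omega

lemma length_mul_of_noDesc (J : Set B) (u v : W) (h : NoDesc cs J u) (hv : v ∈ par cs J) :
    cs.length (u * v) = cs.length u + cs.length v :=
  length_of_min cs J u (min_of_noDesc cs J u h) v hv

lemma fact_unique (J : Set B) (u v u' v' : W) (h : NoDesc cs J u) (h' : NoDesc cs J u')
    (hv : v ∈ par cs J) (hv' : v' ∈ par cs J) (he : u * v = u' * v') : u = u' ∧ v = v' := by
  have hx : v * v'⁻¹ ∈ par cs J := mul_mem hv (inv_mem hv')
  have hu : u' = u * (v * v'⁻¹) := by rw [← mul_assoc, he]; simp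
  have h1 := length_mul_of_noDesc cs J u _ h hx
  have h2 := length_mul_of_noDesc cs J u' _ h' (inv_mem hx)
  have hu' : u' * (v * v'⁻¹)⁻¹ = u := by rw [hu, mul_inv_cancel_right]
  rw [hu', cs.length_inv] at h2
  rw [← hu] at h1
  have h3 : cs.length (v * v'⁻¹) = 0 := by omega
  rw [cs.length_eq_zero_iff] at h3
  have h4 : v = v' := by rwa [mul_inv_eq_one] at h3
  subst h4
  exact ⟨by simpa using he, rfl⟩

lemma finite_length_le [Finite B] (N : ℕ) : {w : W | cs.length w ≤ N}.Finite := by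
  refine ((List.finite_length_le B N).image cs.wordProd).subset ?_
  intro w hw
  obtain ⟨ω, hr, rfl⟩ := cs.exists_isReduced w
  exact ⟨ω, by have := hr.eq; simp at hw ⊢; omega, rfl⟩

lemma finite_of_all_desc [Finite B] (I : Set B) (w : W)
    (h : ∀ i ∈ I, cs.IsRightDescent w i) : Finite (par cs I) := by
  have key : ∀ ω : List B, (∀ i ∈ ω, i ∈ I) → cs.IsReduced ω →
      cs.length w = cs.length (w * (cs.wordProd ω)⁻¹) + cs.length (cs.wordProd ω) := by
    intro ω
    induction ω using List.reverseRecOn with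
    | nil => simp
    | append_singleton ω i ih =>
      intro hI hr
      have hr' : cs.IsReduced ω := by simpa using hr.take ω.length
      have ih := ih (fun k hk => hI k (by simp [hk])) hr'
      have hi : i ∈ I := hI i (by simp)
      have l1 := hr.eq
      have l2 := hr'.eq
      rw [List.length_append, List.length_singleton] at l1
      rw [cs.wordProd_append, cs.wordProd_singleton] at l1 ⊢
      generalize cs.wordProd ω = u at *
      have e1 : w * (u * cs.simple i)⁻¹ = w * u⁻¹ * (u * cs.simple i * u⁻¹) := by
        simp [mul_assoc]
      have h2 := cs.length_mul_le (w * (u * cs.simple i)⁻¹) (u * cs.simple i)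
      rw [inv_mul_cancel_right] at h2
      have := exch2 cs (w * u⁻¹) u i (by rw [inv_mul_cancel_right]; exact h i hi)
      rw [← e1] at this
      rcases this with h' | h' <;> omega
  refine Set.Finite.to_subtype ((finite_length_le cs (cs.length w)).subset ?_)
  intro u hu
  obtain ⟨ω, hI, hr, rfl⟩ := par_reduced cs I u hu
  have := key ω hI hr
  change cs.length (cs.wordProd ω) ≤ cs.length w
  omega

/-- generating function of a set -/
noncomputable def gf (X : Set W) : PowerSeries ℤ :=
  PowerSeries.mk fun k => (Nat.card {w : W // w ∈ X ∧ cs.length w = k} : ℤ)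

lemma finite_level [Finite B] (X : Set W) (k : ℕ) : Finite {w : W // w ∈ X ∧ cs.length w = k} :=
  Set.Finite.to_subtype ((finite_length_le cs k).subset fun _ hw => hw.2.le)

lemma gf_mul [Finite B] (I J : Set B) (hJI : J ⊆ I) :
    gf cs {w | w ∈ par cs I ∧ NoDesc cs J w} * gf cs (par cs J : Set W) =
      gf cs (par cs I : Set W) := by
  have hsub : par cs J ≤ par cs I := Subgroup.closure_mono (Set.image_mono hJI)
  ext k
  rw [PowerSeries.coeff_mul]
  simp only [gf, PowerSeries.coeff_mk]
  have := fun X k => finite_level cs X k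
  let f : (Σ p : Finset.HasAntidiagonal.antidiagonal k,
      {w : W // w ∈ {w | w ∈ par cs I ∧ NoDesc cs J w} ∧ cs.length w = p.1.1} ×
      {w : W // w ∈ (par cs J : Set W) ∧ cs.length w = p.1.2}) →
      {w : W // w ∈ (par cs I : Set W) ∧ cs.length w = k} := fun x =>
    ⟨x.2.1.1 * x.2.2.1, mul_mem x.2.1.2.1.1 (hsub x.2.2.2.1), by
      rw [length_mul_of_noDesc cs J _ _ x.2.1.2.1.2 x.2.2.2.1, x.2.1.2.2, x.2.2.2.2]
      exact Finset.HasAntidiagonal.mem_antidiagonal.mp x.1.2⟩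
  have hf : Function.Bijective f := by
    constructor
    · rintro ⟨⟨⟨a, b⟩, hp⟩, ⟨u, hu, hu2⟩, ⟨v, hv, hv2⟩⟩
        ⟨⟨⟨a', b'⟩, hp'⟩, ⟨u', hu', hu2'⟩, ⟨v', hv', hv2'⟩⟩ h
      have h : u * v = u' * v' := congrArg Subtype.val h
      obtain ⟨rfl, rfl⟩ := fact_unique cs J u v u' v' hu.2 hu'.2 hv hv' h
      dsimp only at hu2 hu2' hv2 hv2'
      subst hu2 hv2 hu2' hv2'
      rfl
    · rintro ⟨w, hw, hk⟩
      obtain ⟨u, v, hv, rfl, hmin⟩ := exists_min cs J w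
      have hu := noDesc_of_min cs J u hmin
      have hl := length_mul_of_noDesc cs J u v hu hv
      refine ⟨⟨⟨(cs.length u, cs.length v), by simp; omega⟩,
        ⟨u, ⟨?_, hu⟩, rfl⟩, ⟨v, hv, rfl⟩⟩, rfl⟩
      simpa using mul_mem hw (inv_mem (hsub hv))
  rw [← Nat.card_congr (Equiv.ofBijective f hf), Nat.card_sigma]
  simp only [Nat.card_prod]
  push_cast
  rw [← Finset.sum_coe_sort (Finset.HasAntidiagonal.antidiagonal k)]

lemma gf_alt [Finite B] (I : Finset B) (hinf : ¬ Finite (par cs (I : Set B))) :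
    ∑ J ∈ I.powerset, (-1 : PowerSeries ℤ) ^ J.card *
      gf cs {w | w ∈ par cs (I : Set B) ∧ NoDesc cs (J : Set B) w} = 0 := by
  classical
  ext k
  have hF : {w : W | w ∈ par cs (I : Set B) ∧ cs.length w = k}.Finite :=
    (finite_length_le cs k).subset fun _ hw => hw.2.le
  have hcard : ∀ J : Finset B,
      (Nat.card {w : W // w ∈ {w | w ∈ par cs (I : Set B) ∧ NoDesc cs (J : Set B) w} ∧
        cs.length w = k} : ℤ) =
      ∑ w ∈ hF.toFinset, if NoDesc cs (J : Set B) w then 1 else 0 := by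
    intro J
    rw [Finset.sum_boole, Nat.subtype_card (hF.toFinset.filter fun w => NoDesc cs (J : Set B) w)]
    intro w
    simp
    tauto
  have hco : ∀ (m : ℕ) (g : PowerSeries ℤ),
      PowerSeries.coeff k ((-1 : PowerSeries ℤ) ^ m * g) = (-1) ^ m * PowerSeries.coeff k g := by
    intro m g
    rcases neg_one_pow_eq_or (PowerSeries ℤ) m with h | h <;>
    rcases Nat.even_or_odd m with h' | h' <;> simp [h'.neg_one_pow]
  simp only [map_sum, hco, gf, PowerSeries.coeff_mk, hcard, map_zero, Finset.mul_sum]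
  rw [Finset.sum_comm]
  apply Finset.sum_eq_zero
  intro w hw
  have hne : (I.filter fun i => ¬ cs.IsRightDescent w i).Nonempty := by
    rw [Finset.filter_nonempty_iff]
    by_contra hcon
    push Not at hcon
    exact hinf (finite_of_all_desc cs (I : Set B) w fun i hi => hcon i hi)
  refine Eq.trans ?_ (Finset.sum_powerset_neg_one_pow_card_of_nonempty hne)
  simp only [mul_ite, mul_one, mul_zero]
  rw [← Finset.sum_filter]
  apply Finset.sum_congr _ fun _ _ => rfl
  ext J
  simp only [Finset.mem_filter, Finset.mem_powerset, NoDesc, Finset.mem_coe, Finset.subset_iff]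
  constructor
  · rintro ⟨h1, h2⟩ i hi; exact ⟨h1 hi, h2 i hi⟩
  · intro h; exact ⟨fun i hi => (h hi).1, fun i hi => (h hi).2⟩

lemma gf_const (I : Set B) : PowerSeries.coeff 0 (gf cs (par cs I : Set W)) = 1 := by
  simp only [gf, PowerSeries.coeff_mk]
  rw [Nat.cast_eq_one, Nat.card_eq_one_iff_exists]
  refine ⟨⟨1, one_mem _, by simp⟩, ?_⟩
  rintro ⟨w, hw, h0⟩
  rw [cs.length_eq_zero_iff] at h0
  subst h0
  rfl

lemma gf_poly (I : Set B) (hfin : Finite (par cs I)) :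
    ∃ p : Polynomial ℤ, p.coeff 0 = 1 ∧ (p : PowerSeries ℤ) = gf cs (par cs I : Set W) := by
  have hX : (par cs I : Set W).Finite := hfin
  obtain ⟨N, hN⟩ := (hX.image cs.length).bddAbove
  have h : ((PowerSeries.trunc (N + 1) (gf cs (par cs I : Set W)) : Polynomial ℤ) :
      PowerSeries ℤ) = gf cs (par cs I : Set W) := by
    ext k
    rw [Polynomial.coeff_coe, PowerSeries.coeff_trunc]
    split_ifs with hk
    · rfl
    · simp only [gf, PowerSeries.coeff_mk]
      have : IsEmpty {w : W // w ∈ (par cs I : Set W) ∧ cs.length w = k} := by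
        constructor
        rintro ⟨w, hw, rfl⟩
        have := hN ⟨w, hw, rfl⟩
        omega
      simp
  refine ⟨_, ?_, h⟩
  rw [← Polynomial.coeff_coe, h, gf_const]

lemma main_aux [Finite B] (L : Polynomial ℤ)
    (hL : ∀ I : Set B, Finite (par cs I) → ∀ p : Polynomial ℤ,
      (p : PowerSeries ℤ) = gf cs (par cs I : Set W) → p ∣ L) (I : Finset B) :
    ∃ R : Polynomial ℤ, (R : PowerSeries ℤ) * gf cs (par cs (I : Set B) : Set W) = L := by
  classical
  induction I using Finset.strongInduction with
  | H I ih =>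
    by_cases hfin : Finite (par cs (I : Set B))
    · obtain ⟨p, -, hp⟩ := gf_poly cs (I : Set B) hfin
      obtain ⟨R, rfl⟩ := hL _ hfin p hp
      exact ⟨R, by rw [← hp, Polynomial.coe_mul, mul_comm]⟩
    · have h := gf_alt cs I hfin
      choose! R hR using ih
      have hPne : gf cs (par cs (I : Set B) : Set W) ≠ 0 := by
        intro h0
        have := gf_const cs (I : Set B)
        rw [h0] at this
        simp at this
      have hI : gf cs {w | w ∈ par cs (I : Set B) ∧ NoDesc cs (I : Set B) w} = 1 := by
        have := gf_mul cs (I : Set B) (I : Set B) subset_rfl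
        exact mul_right_cancel₀ hPne (by rw [this, one_mul])
      rw [← Finset.sum_erase_add _ _ (Finset.mem_powerset_self I), hI, mul_one] at h
      have h2 := congrArg (fun x => (L : PowerSeries ℤ) * x) h
      simp only [mul_add, Finset.mul_sum, mul_zero] at h2
      have h3 : ∀ J ∈ I.powerset.erase I, (L : PowerSeries ℤ) * ((-1 : PowerSeries ℤ) ^ J.card *
          gf cs {w | w ∈ par cs (I : Set B) ∧ NoDesc cs (J : Set B) w}) =
          (-1) ^ J.card * (R J : PowerSeries ℤ) * gf cs (par cs (I : Set B) : Set W) := by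
        intro J hJ
        rw [Finset.mem_erase, Finset.mem_powerset] at hJ
        rw [← hR J (Finset.ssubset_iff_subset_ne.mpr ⟨hJ.2, hJ.1⟩),
          ← gf_mul cs (I : Set B) (J : Set B) (by exact_mod_cast hJ.2)]
        ring
      rw [Finset.sum_congr rfl h3, ← Finset.sum_mul] at h2
      have hsq : ((-1 : PowerSeries ℤ) ^ I.card) * (-1) ^ I.card = 1 := by
        rw [← mul_pow]; simp
      refine ⟨-(-1) ^ I.card * ∑ J ∈ I.powerset.erase I, (-1) ^ J.card * R J, ?_⟩
      have hcoe : ((-(-1) ^ I.card * ∑ J ∈ I.powerset.erase I, (-1) ^ J.card * R J :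
          Polynomial ℤ) : PowerSeries ℤ) =
          -(-1) ^ I.card * ∑ J ∈ I.powerset.erase I, (-1) ^ J.card * (R J : PowerSeries ℤ) := by
        rw [← Polynomial.coeToPowerSeries.ringHom_apply]
        simp only [map_mul, map_neg, map_pow, map_one, map_sum,
          Polynomial.coeToPowerSeries.ringHom_apply]
      rw [hcoe]
      linear_combination (-(-1) ^ I.card) * h2 + (L : PowerSeries ℤ) * hsq

end PNL

/-- let `A` be a generalized Cartan matrix with infinite Weyl group. Each
parabolic Poincaré series `P_I(A)` with `W_I(A)` finite is a polynomial with constant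
term `1`; and if `L` is a least common multiple, normalized to have constant term `1`,
of these polynomials, then there is a polynomial `R` with `R · P(A) = L`. -/
theorem poincare_numerator_lcm {n : ℕ} (A : Matrix (Fin n) (Fin n) ℤ) (hA : IsGCM A)
    (hinf : Infinite (gcmCoxeter A).Group) :
    (∀ I : Set (Fin n),
      Finite (Subgroup.closure ((gcmCoxeter A).toCoxeterSystem.simple '' I)) →
      ∃ p : Polynomial ℤ, p.coeff 0 = 1 ∧
        (p : PowerSeries ℤ) = coxSubPoincare (gcmCoxeter A) I) ∧
    (∀ L : Polynomial ℤ, L.coeff 0 = 1 →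
      (∀ I : Set (Fin n),
        Finite (Subgroup.closure ((gcmCoxeter A).toCoxeterSystem.simple '' I)) →
        ∀ p : Polynomial ℤ,
          (p : PowerSeries ℤ) = coxSubPoincare (gcmCoxeter A) I → p ∣ L) →
      (∀ L' : Polynomial ℤ,
        (∀ I : Set (Fin n),
          Finite (Subgroup.closure ((gcmCoxeter A).toCoxeterSystem.simple '' I)) →
          ∀ p : Polynomial ℤ,
            (p : PowerSeries ℤ) = coxSubPoincare (gcmCoxeter A) I → p ∣ L') →
        L ∣ L') →
      ∃ R : Polynomial ℤ,
        (R : PowerSeries ℤ) * coxPoincare (gcmCoxeter A) = (L : PowerSeries ℤ)) := by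
  refine ⟨fun I hI => PNL.gf_poly (gcmCoxeter A).toCoxeterSystem I hI, ?_⟩
  intro L _ hL _
  obtain ⟨R, hR⟩ := PNL.main_aux (gcmCoxeter A).toCoxeterSystem L hL Finset.univ
  refine ⟨R, ?_⟩
  rw [← hR]
  congr 1
  have htop : PNL.par (gcmCoxeter A).toCoxeterSystem
      ((Finset.univ : Finset (Fin n)) : Set (Fin n)) = ⊤ := by
    rw [PNL.par, Finset.coe_univ, Set.image_univ, CoxeterSystem.subgroup_closure_range_simple]
  rw [htop]
  ext k
  simp only [coxPoincare, PNL.gf, PowerSeries.coeff_mk]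
  congr 1
  exact Nat.card_congr (Equiv.subtypeEquivRight fun w => by simp)
end

section
/- Let A be an n×n generalized Cartan matrix whose Weyl group W(A) is infinite and whose Coxeter graph is connected (the graph on vertices {1,…,n} with an edge joining i and j iff m_{ij} ≥ 3). Then deg P(A) ≥ 0; that is, for all nonzero polynomials Q, R ∈ ℚ[t] with R · P(A) = Q in ℚ⟦t⟧, one has deg R ≤ deg Q. -/
open PowerSeries

/-- The Poincaré series of a Coxeter matrix, with rational coefficients. -/
noncomputable def coxPoincareQ {B : Type*} (M : CoxeterMatrix B) : PowerSeries ℚ :=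
  PowerSeries.mk fun k =>
    (Nat.card {w : M.Group // M.toCoxeterSystem.length w = k} : ℚ)

/-- The Coxeter graph of a Coxeter matrix: vertices are joined iff the corresponding
entry is at least `3` (with `∞` encoded as `0`). -/
def coxeterGraph {B : Type*} (M : CoxeterMatrix B) : SimpleGraph B :=
  SimpleGraph.fromRel fun i j => M i j = 0 ∨ 3 ≤ M i j

namespace PDN
section cox
variable {B : Type*} {W : Type*} [Group W] {M : CoxeterMatrix B} (cs : CoxeterSystem M W)

theorem end_mul {α : Type*} (f g : Function.End α) (p : α) : (f * g) p = f (g p) := rfl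

theorem end_one {α : Type*} (p : α) : (1 : Function.End α) p = p := rfl

open Classical in
/-- The action of a generator on `W × ZMod 2`. -/
noncomputable def gen (i : B) : Function.End (W × ZMod 2) :=
  fun p => (cs.simple i * p.1 * cs.simple i, p.2 + if p.1 = cs.simple i then 1 else 0)

open Classical in
theorem gen_pow (i j : B) (m : ℕ) (x : W) (z : ZMod 2) :
    ((gen cs i * gen cs j) ^ m) (x, z) =
      ((cs.simple i * cs.simple j) ^ m * x * ((cs.simple i * cs.simple j) ^ m)⁻¹,
        z + ∑ k ∈ Finset.range (2 * m),
          if x = cs.simple j * (cs.simple i * cs.simple j) ^ k then 1 else 0) := by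
  have key : ∀ k : ℕ, ((cs.simple i * cs.simple j) ^ k)⁻¹ * cs.simple j
      = cs.simple j * (cs.simple i * cs.simple j) ^ k := by
    intro k
    induction k with
    | zero => simp
    | succ k ih =>
      rw [pow_succ, mul_inv_rev, mul_assoc, ih, mul_inv_rev, cs.inv_simple, cs.inv_simple,
        ← pow_succ, pow_succ']
      simp [mul_assoc]
  induction m with
  | zero => simp [end_one]
  | succ m ih =>
    rw [pow_succ', end_mul, ih, end_mul]
    have e1 : ((cs.simple i * cs.simple j) ^ m * x * ((cs.simple i * cs.simple j) ^ m)⁻¹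
        = cs.simple j) ↔ x = cs.simple j * (cs.simple i * cs.simple j) ^ (2 * m) := by
      rw [two_mul, pow_add, ← mul_assoc, ← key, mul_inv_eq_iff_eq_mul, ← eq_inv_mul_iff_mul_eq,
        mul_assoc]
    have e2 : (cs.simple j * ((cs.simple i * cs.simple j) ^ m * x *
        ((cs.simple i * cs.simple j) ^ m)⁻¹) * cs.simple j
        = cs.simple i) ↔ x = cs.simple j * (cs.simple i * cs.simple j) ^ (2 * m + 1) := by
      have : 2 * m + 1 = m + (1 + m) := by ring
      have kk : cs.simple j * (cs.simple i * cs.simple j) ^ (m + (1 + m)) =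
          ((cs.simple i * cs.simple j) ^ m)⁻¹ * cs.simple j *
            (cs.simple i * cs.simple j * (cs.simple i * cs.simple j) ^ m) := by
        rw [pow_add, ← mul_assoc, ← key, pow_add, pow_one]
      rw [this, kk, ← _root_.eq_mul_inv_iff_mul_eq, ← eq_inv_mul_iff_mul_eq, mul_inv_eq_iff_eq_mul,
        ← eq_inv_mul_iff_mul_eq, cs.inv_simple]
      simp only [mul_assoc]
    simp only [gen, e1, e2]
    rw [show 2 * (m + 1) = 2 * m + 1 + 1 by ring, Finset.sum_range_succ, Finset.sum_range_succ]
    refine Prod.ext ?_ ?_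
    · simp [pow_succ', mul_assoc]
    · simp [add_assoc]

theorem gen_liftable : M.IsLiftable (gen cs) := by
  classical
  intro i j
  funext ⟨x, z⟩
  rw [gen_pow, cs.simple_mul_simple_pow, two_mul, Finset.sum_range_add]
  simp only [pow_add, cs.simple_mul_simple_pow, one_mul, mul_one, inv_one]
  rw [CharTwo.add_self_eq_zero, add_zero]
  rfl

/-- The action of `W` on `W × ZMod 2`. -/
noncomputable def act : W →* Function.End (W × ZMod 2) := cs.lift ⟨gen cs, gen_liftable cs⟩

open Classical in
theorem act_word (ω : List B) (x : W) (z : ZMod 2) :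
    act cs (cs.wordProd ω) (x, z) =
      (cs.wordProd ω * x * (cs.wordProd ω)⁻¹, z + ((cs.rightInvSeq ω).count x : ZMod 2)) := by
  induction ω with
  | nil => simp [end_one]
  | cons i ω ih =>
    rw [cs.wordProd_cons, map_mul, end_mul, ih]
    have : act cs (cs.simple i) = gen cs i := cs.lift_apply_simple (gen_liftable cs) i
    rw [this]
    simp only [gen, CoxeterSystem.rightInvSeq, List.count_cons]
    refine Prod.ext (by simp [mul_assoc]) ?_
    have e : (cs.wordProd ω * x * (cs.wordProd ω)⁻¹ = cs.simple i) ↔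
        (cs.wordProd ω)⁻¹ * cs.simple i * cs.wordProd ω = x := by
      rw [mul_inv_eq_iff_eq_mul, ← eq_inv_mul_iff_mul_eq, eq_comm, mul_assoc]
    simp only [e, beq_iff_eq]
    push_cast
    ring

theorem exchange (ω : List B) (i : B)
    (h : cs.length (cs.wordProd ω * cs.simple i) < cs.length (cs.wordProd ω)) :
    ∃ j < ω.length, cs.wordProd ω * cs.simple i = cs.wordProd (ω.eraseIdx j) := by
  classical
  have hmem : cs.simple i ∈ cs.rightInvSeq ω := by
    by_contra hn
    obtain ⟨ω', hr, hw'⟩ := cs.exists_isReduced (cs.wordProd ω * cs.simple i)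
    have h1 := act_word cs ω' (cs.simple i) 0
    rw [← hw', map_mul, end_mul] at h1
    have : act cs (cs.simple i) = gen cs i := cs.lift_apply_simple (gen_liftable cs) i
    rw [this] at h1
    simp only [gen, if_true] at h1
    rw [act_word, cs.simple_mul_simple_self, one_mul, List.count_eq_zero_of_not_mem hn] at h1
    have h2 := congrArg Prod.snd h1
    simp only at h2
    have hm : cs.simple i ∈ cs.rightInvSeq ω' := by
      by_contra hn'
      rw [List.count_eq_zero_of_not_mem hn'] at h2
      simp at h2
    have := (cs.isRightInversion_of_mem_rightInvSeq hr hm).2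
    rw [← hw'] at this
    simp at this
    omega
  obtain ⟨j, hj, he⟩ := List.getElem_of_mem hmem
  rw [cs.length_rightInvSeq] at hj
  refine ⟨j, hj, ?_⟩
  rw [← cs.wordProd_mul_getD_rightInvSeq, List.getD_eq_getElem _ _ (by simpa using hj), he]

theorem exchange_split (x y : W) (i : B) (hy : cs.length (y * cs.simple i) = cs.length y + 1)
    (h : cs.length (x * y * cs.simple i) < cs.length (x * y)) :
    ∃ x', cs.length x' < cs.length x ∧ x * y * cs.simple i = x' * y := by
  obtain ⟨a, ha, rfl⟩ := cs.exists_isReduced x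
  obtain ⟨b, hb, rfl⟩ := cs.exists_isReduced y
  rw [← cs.wordProd_append] at h
  obtain ⟨j, hj, he⟩ := exchange cs _ i h
  rw [List.length_append] at hj
  rw [ha.eq]
  rcases lt_or_ge j a.length with hja | hja
  · refine ⟨cs.wordProd (a.eraseIdx j), ?_, ?_⟩
    · refine (cs.length_wordProd_le _).trans_lt ?_
      rw [List.length_eraseIdx_of_lt hja]; omega
    · rw [← cs.wordProd_append, he, List.eraseIdx_append_of_lt_length hja, cs.wordProd_append]
  · exfalso
    rw [List.eraseIdx_append_of_length_le hja, cs.wordProd_append, cs.wordProd_append, mul_assoc,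
      mul_right_inj] at he
    have h3 := cs.length_wordProd_le (b.eraseIdx (j - a.length))
    rw [← he, hy, hb.eq, List.length_eraseIdx_of_lt (by omega)] at h3
    omega

/-- The standard parabolic subgroup, as a set. -/
def par (T : Finset B) : Set W := {w | ∃ ω : List B, (∀ i ∈ ω, i ∈ T) ∧ cs.wordProd ω = w}

variable {cs} in
theorem par_one (T : Finset B) : (1 : W) ∈ par cs T := ⟨[], by simp⟩

variable {cs} in
theorem par_mul {T : Finset B} {x y : W} (hx : x ∈ par cs T) (hy : y ∈ par cs T) :
    x * y ∈ par cs T := by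
  obtain ⟨a, ha, rfl⟩ := hx
  obtain ⟨b, hb, rfl⟩ := hy
  refine ⟨a ++ b, ?_, cs.wordProd_append a b⟩
  intro i hi
  rcases List.mem_append.1 hi with h | h
  · exact ha i h
  · exact hb i h

variable {cs} in
theorem par_inv {T : Finset B} {x : W} (hx : x ∈ par cs T) : x⁻¹ ∈ par cs T := by
  obtain ⟨a, ha, rfl⟩ := hx
  exact ⟨a.reverse, by simpa using ha, by simp⟩

variable {cs} in
theorem par_simple {T : Finset B} {i : B} (hi : i ∈ T) : cs.simple i ∈ par cs T :=
  ⟨[i], by simpa using hi, by simp⟩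

variable {cs} in
theorem par_mono {T U : Finset B} (h : U ⊆ T) : par cs U ⊆ par cs T := by
  rintro x ⟨a, ha, rfl⟩
  exact ⟨a, fun i hi => h (ha i hi), rfl⟩

theorem par_descent {T : Finset B} {v : W} (hv : v ∈ par cs T) (h1 : v ≠ 1) :
    ∃ i ∈ T, cs.length (v * cs.simple i) + 1 = cs.length v := by
  obtain ⟨ω, hω, rfl⟩ := hv
  induction hn : ω.length using Nat.strong_induction_on generalizing ω with
  | _ n ih =>
    rcases List.eq_nil_or_concat ω with rfl | ⟨a, i, rfl⟩
    · simp at h1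
    have hiT : i ∈ T := hω i (by simp)
    have haT : ∀ k ∈ a, k ∈ T := fun k hk => hω k (by simp [hk])
    rcases cs.length_mul_simple (cs.wordProd a) i with h | h
    · refine ⟨i, hiT, ?_⟩
      rw [cs.wordProd_concat]
      simp [h]
    · obtain ⟨j, hj, he⟩ := exchange cs a i (by omega)
      rw [cs.wordProd_concat, he] at h1 ⊢
      exact ih (a.eraseIdx j).length (by
        rw [List.length_eraseIdx_of_lt hj, ← hn]; simp) _
        (fun k hk => haT k (List.mem_of_mem_eraseIdx hk)) h1 rfl

theorem par_induct {T : Finset B} {p : W → Prop} (one : p 1)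
    (step : ∀ y i, y ∈ par cs T → i ∈ T → cs.length (y * cs.simple i) = cs.length y + 1 →
      p y → p (y * cs.simple i)) {v : W} (hv : v ∈ par cs T) : p v := by
  induction hn : cs.length v using Nat.strong_induction_on generalizing v with
  | _ n ih =>
    by_cases h1 : v = 1
    · rwa [h1]
    obtain ⟨i, hi, hl⟩ := par_descent cs hv h1
    have hm := par_mul hv (par_simple (cs := cs) hi)
    have := step (v * cs.simple i) i hm hi (by simp; omega) (ih _ (by omega) hm rfl)
    simpa using this

theorem full_descent {T : Finset B} {w : W}
    (hw : ∀ i ∈ T, cs.length (w * cs.simple i) < cs.length w) {v : W} (hv : v ∈ par cs T) :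
    ∃ x, w = x * v ∧ cs.length w = cs.length x + cs.length v := by
  refine par_induct cs (T := T) (p := fun v => ∃ x, w = x * v ∧ cs.length w = cs.length x + cs.length v)
    ⟨w, by simp⟩ ?_ hv
  rintro y i hy hi hl ⟨x, rfl, hx⟩
  obtain ⟨x', hx', he⟩ := exchange_split cs x y i hl (hw i hi)
  have e : x * y = x' * (y * cs.simple i) := by
    rw [← mul_assoc, ← he]; simp
  refine ⟨x', e, ?_⟩
  have := cs.length_mul_le x' (y * cs.simple i)
  rw [← e] at this
  omega

theorem min_add {U : Finset B} {u : W}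
    (hu : ∀ v ∈ par cs U, cs.length u ≤ cs.length (u * v)) {v : W} (hv : v ∈ par cs U) :
    cs.length (u * v) = cs.length u + cs.length v := by
  refine par_induct cs (T := U) (p := fun v => cs.length (u * v) = cs.length u + cs.length v)
    (by simp) ?_ hv
  intro y i hy hi hl ih
  rcases cs.length_mul_simple (u * y) i with h | h
  · rw [← mul_assoc]; omega
  · exfalso
    obtain ⟨x', hx', he⟩ := exchange_split cs u y i hl (by omega)
    have e : x' = u * (y * cs.simple i * y⁻¹) := by
      rw [← mul_assoc, ← mul_assoc, he]; simp
    have := hu _ (par_mul (par_mul hy (par_simple hi)) (par_inv hy))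
    rw [← e] at this
    omega

theorem exists_min (U : Finset B) (w : W) : ∃ v ∈ par cs U,
    ∀ v' ∈ par cs U, cs.length (w * v) ≤ cs.length (w * v * v') := by
  obtain ⟨v, hv, hmin⟩ := exists_minimalFor_of_wellFoundedLT (fun v => v ∈ par cs U)
    (fun v => cs.length (w * v)) ⟨1, par_one U⟩
  refine ⟨v, hv, fun v' hv' => ?_⟩
  by_contra hlt
  push Not at hlt
  rw [mul_assoc] at hlt
  have := hmin (par_mul hv hv') hlt.le
  simp only at this
  omega

/-- Minimal coset representatives. -/
def mcr (T U : Finset B) : Set W :=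
  {w | w ∈ par cs T ∧ ∀ i ∈ U, ¬ cs.length (w * cs.simple i) < cs.length w}

theorem mcr_min {T U : Finset B} {u : W} (hu : u ∈ mcr cs T U) :
    ∀ v ∈ par cs U, cs.length u ≤ cs.length (u * v) := by
  obtain ⟨v, hv, hmin⟩ := exists_min cs U u
  by_cases h1 : v = 1
  · simpa [h1] using hmin
  exfalso
  have h1' : v⁻¹ ≠ 1 := by simpa using h1
  obtain ⟨i, hi, hl⟩ := par_descent cs (par_inv hv) h1'
  have a1 := min_add cs hmin (par_inv hv)
  have a2 := min_add cs hmin (par_mul (par_inv hv) (par_simple hi))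
  apply hu.2 i hi
  rw [show u = u * v * v⁻¹ by simp, mul_assoc _ _ (cs.simple i)]
  omega

/-- The coset factorization. -/
noncomputable def fac {T U : Finset B} (hUT : U ⊆ T) (k : ℕ) :
    (Σ p : Finset.HasAntidiagonal.antidiagonal k, {u : W // u ∈ mcr cs T U ∧ cs.length u = p.1.1} ×
      {v : W // v ∈ par cs U ∧ cs.length v = p.1.2}) ≃
    {w : W // w ∈ par cs T ∧ cs.length w = k} := by
  refine Equiv.ofBijective (fun q => ⟨q.2.1.1 * q.2.2.1,
    par_mul q.2.1.2.1.1 (par_mono hUT q.2.2.2.1), ?_⟩) ⟨?_, ?_⟩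
  · rw [min_add cs (mcr_min cs q.2.1.2.1) q.2.2.2.1, q.2.1.2.2, q.2.2.2.2]
    exact Finset.HasAntidiagonal.mem_antidiagonal.1 q.1.2
  · rintro ⟨⟨⟨a, b⟩, hab⟩, ⟨u, hu, hul⟩, ⟨v, hv, hvl⟩⟩ ⟨⟨⟨a', b'⟩, hab'⟩, ⟨u', hu', hul'⟩, ⟨v', hv', hvl'⟩⟩ h
    simp only [Subtype.mk.injEq] at h hul hvl hul' hvl'
    have m1 := min_add cs (mcr_min cs hu) (par_mul hv (par_inv hv'))
    have m2 := min_add cs (mcr_min cs hu') (par_mul hv' (par_inv hv))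
    rw [← mul_assoc, h, mul_inv_cancel_right] at m1
    rw [← mul_assoc, ← h, mul_inv_cancel_right] at m2
    have : cs.length (v * v'⁻¹) = 0 := by omega
    rw [cs.length_eq_zero_iff, mul_inv_eq_one] at this
    subst this
    have := mul_right_cancel h
    subst this
    subst hul hvl hul' hvl'
    rfl
  · rintro ⟨w, hw, hl⟩
    obtain ⟨v, hv, hmin⟩ := exists_min cs U w
    have ha := min_add cs hmin (par_inv hv)
    rw [mul_inv_cancel_right] at ha
    refine ⟨⟨⟨(cs.length (w * v), cs.length v⁻¹), ?_⟩, ⟨w * v, ⟨par_mul hw (par_mono hUT hv), ?_⟩, rfl⟩,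
      ⟨v⁻¹, par_inv hv, rfl⟩⟩, ?_⟩
    · rw [Finset.HasAntidiagonal.mem_antidiagonal]; simp only; omega
    · intro i hi
      exact not_lt.2 (hmin _ (par_simple hi))
    · simp

theorem fin_le [Finite B] (N : ℕ) : {w : W | cs.length w ≤ N}.Finite := by
  refine ((List.finite_length_le B N).image cs.wordProd).subset ?_
  intro w hw
  obtain ⟨a, ha, rfl⟩ := cs.exists_isReduced w
  exact ⟨a, by simpa [ha.eq] using hw, rfl⟩

/-- Generating function of a subset. -/
noncomputable def G (X : Set W) : PowerSeries ℚ :=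
  PowerSeries.mk fun k => (Nat.card {w : W // w ∈ X ∧ cs.length w = k} : ℚ)

instance fin_lev [Finite B] (X : Set W) (k : ℕ) : Finite {w : W // w ∈ X ∧ cs.length w = k} :=
  ((fin_le cs k).subset (fun _ hw => hw.2.le : {w : W | w ∈ X ∧ cs.length w = k} ⊆ _)).to_subtype

theorem G_mul [Finite B] {T U : Finset B} (hUT : U ⊆ T) :
    G cs (par cs T) = G cs (mcr cs T U) * G cs (par cs U) := by
  ext k
  rw [PowerSeries.coeff_mul]
  simp only [G, PowerSeries.coeff_mk]
  rw [← Nat.card_congr (fac cs hUT k), Nat.card_sigma]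
  simp only [Nat.card_prod]
  rw [Finset.univ_eq_attach, Finset.sum_attach (Finset.HasAntidiagonal.antidiagonal k) (fun p =>
    Nat.card {u : W // u ∈ mcr cs T U ∧ cs.length u = p.1} *
      Nat.card {v : W // v ∈ par cs U ∧ cs.length v = p.2})]
  push_cast
  rfl

theorem alt_sum [Finite B] {T : Finset B} (hT : (par cs T).Infinite) :
    ∑ U ∈ T.powerset, (-1 : PowerSeries ℚ) ^ U.card * G cs (mcr cs T U) = 0 := by
  classical
  ext k
  have hfin : {w : W | w ∈ par cs T ∧ cs.length w = k}.Finite :=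
    (fin_le cs k).subset (fun _ hw => hw.2.le)
  have hcard : ∀ U : Finset B, (Nat.card {w : W // w ∈ mcr cs T U ∧ cs.length w = k} : ℚ) =
      ∑ w ∈ hfin.toFinset,
        if ∀ i ∈ U, ¬ cs.length (w * cs.simple i) < cs.length w then (1 : ℚ) else 0 := by
    intro U
    rw [← Finset.sum_filter, Finset.sum_const, nsmul_eq_mul, mul_one, Nat.cast_inj]
    rw [← Nat.card_eq_finsetCard]
    refine Nat.card_congr (Equiv.subtypeEquivRight fun w => ?_)
    simp only [mcr, Finset.mem_filter, Set.Finite.mem_toFinset, Set.mem_ofPred_eq]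
    tauto
  have hc : ∀ U : Finset B, coeff k ((-1 : PowerSeries ℚ) ^ U.card * G cs (mcr cs T U)) =
      (-1 : ℚ) ^ U.card * ∑ w ∈ hfin.toFinset,
        if ∀ i ∈ U, ¬ cs.length (w * cs.simple i) < cs.length w then (1 : ℚ) else 0 := by
    intro U
    have : (-1 : PowerSeries ℚ) ^ U.card = PowerSeries.C ((-1 : ℚ) ^ U.card) := by simp
    rw [this, PowerSeries.coeff_C_mul, ← hcard]
    simp [G]
  rw [map_sum, Finset.sum_congr rfl (fun U _ => hc U)]
  simp only [Finset.mul_sum]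
  rw [Finset.sum_comm, map_zero]
  refine Finset.sum_eq_zero fun w hw => ?_
  simp only [mul_ite, mul_one, mul_zero]
  rw [← Finset.sum_filter]
  have hset : T.powerset.filter (fun U => ∀ i ∈ U, ¬ cs.length (w * cs.simple i) < cs.length w) =
      (T.filter (fun i => ¬ cs.length (w * cs.simple i) < cs.length w)).powerset := by
    ext U
    simp only [Finset.mem_filter, Finset.mem_powerset, Finset.subset_iff]
    grind
  rw [hset]
  have hne : (T.filter (fun i => ¬ cs.length (w * cs.simple i) < cs.length w)).Nonempty := by
    by_contra hemp
    rw [Finset.not_nonempty_iff_eq_empty, Finset.filter_eq_empty_iff] at hemp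
    push Not at hemp
    refine hT ((fin_le cs (cs.length w)).subset fun v hv => ?_)
    obtain ⟨x, -, hx⟩ := full_descent cs (fun i hi => hemp hi) hv
    simp only [Set.mem_ofPred_eq]
    omega
  have := Finset.sum_powerset_neg_one_pow_card_of_nonempty hne
  exact_mod_cast this

/-- Rational power series of degree at most zero. -/
def Good (F : PowerSeries ℚ) : Prop :=
  ∃ A D : Polynomial ℚ, D ≠ 0 ∧ A.natDegree ≤ D.natDegree ∧ (D : PowerSeries ℚ) * F = A

theorem Good.add {F H : PowerSeries ℚ} (hF : Good F) (hH : Good H) : Good (F + H) := by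
  obtain ⟨A, D, hD, hd, h⟩ := hF
  obtain ⟨A', D', hD', hd', h'⟩ := hH
  refine ⟨A * D' + A' * D, D * D', mul_ne_zero hD hD', ?_, ?_⟩
  · rw [Polynomial.natDegree_mul hD hD']
    refine (Polynomial.natDegree_add_le _ _).trans (max_le ?_ ?_)
    · exact Polynomial.natDegree_mul_le.trans (by omega)
    · exact Polynomial.natDegree_mul_le.trans (by omega)
  · push_cast
    rw [← h, ← h']
    ring

theorem Good.neg {F : PowerSeries ℚ} (hF : Good F) : Good (-F) := by
  obtain ⟨A, D, hD, hd, h⟩ := hF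
  exact ⟨-A, D, hD, by simpa using hd, by rw [mul_neg, h]; simp⟩

theorem Good.sign {F : PowerSeries ℚ} (hF : Good F) (n : ℕ) : Good ((-1) ^ n * F) := by
  rcases neg_one_pow_eq_or (PowerSeries ℚ) n with h | h
  · rw [h, one_mul]; exact hF
  · rw [h, neg_one_mul]; exact hF.neg

theorem Good.sum {ι : Type*} (s : Finset ι) (f : ι → PowerSeries ℚ) (h : ∀ i ∈ s, Good (f i)) :
    Good (∑ i ∈ s, f i) := by
  classical
  induction s using Finset.induction_on with
  | empty => exact ⟨0, 1, one_ne_zero, by simp, by simp⟩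
  | insert a s ha ih =>
    rw [Finset.sum_insert ha]
    exact (h a (by simp)).add (ih fun i hi => h i (by simp [hi]))

theorem G_const (T : Finset B) : PowerSeries.constantCoeff (G cs (par cs T)) = 1 := by
  rw [← PowerSeries.coeff_zero_eq_constantCoeff_apply, G, PowerSeries.coeff_mk, Nat.cast_eq_one,
    Nat.card_eq_one_iff_unique]
  refine ⟨⟨fun a b => Subtype.ext ?_⟩, ⟨⟨1, par_one T, cs.length_one⟩⟩⟩
  rw [cs.length_eq_zero_iff.1 a.2.2, cs.length_eq_zero_iff.1 b.2.2]

theorem G_ne (T : Finset B) : PowerSeries.constantCoeff (G cs (par cs T)) ≠ 0 := by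
  rw [G_const]; exact one_ne_zero

theorem good_inv [Finite B] (T : Finset B) : Good (G cs (par cs T))⁻¹ := by
  classical
  induction T using Finset.strongInduction with
  | H T ih =>
    by_cases hT : (par cs T).Finite
    · obtain ⟨N, hN⟩ := (hT.image cs.length).bddAbove
      have he : (PowerSeries.trunc (N + 1) (G cs (par cs T)) : PowerSeries ℚ) = G cs (par cs T) := by
        ext k
        rw [Polynomial.coeff_coe, PowerSeries.coeff_trunc]
        split_ifs with hk
        · rfl
        · rw [G, PowerSeries.coeff_mk, eq_comm, Nat.cast_eq_zero]
          have : IsEmpty {w : W // w ∈ par cs T ∧ cs.length w = k} := by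
            refine ⟨fun w => ?_⟩
            have := hN ⟨w.1, w.2.1, rfl⟩
            rw [w.2.2] at this
            omega
          exact Nat.card_of_isEmpty
      refine ⟨1, PowerSeries.trunc (N + 1) (G cs (par cs T)), ?_, by simp, ?_⟩
      · intro h0
        rw [h0] at he
        apply G_ne cs T
        rw [← he]; simp
      · rw [he, PowerSeries.mul_inv_cancel _ (G_ne cs T)]; simp
    · have h := alt_sum cs hT
      have h2 : ∑ U ∈ T.powerset, (-1 : PowerSeries ℚ) ^ U.card * (G cs (par cs U))⁻¹ = 0 := by
        have h3 : ∀ U ∈ T.powerset, (-1 : PowerSeries ℚ) ^ U.card * (G cs (par cs U))⁻¹ =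
            (G cs (par cs T))⁻¹ * ((-1 : PowerSeries ℚ) ^ U.card * G cs (mcr cs T U)) := by
          intro U hU
          have e := G_mul cs (Finset.mem_powerset.1 hU)
          have e2 : G cs (mcr cs T U) = G cs (par cs T) * (G cs (par cs U))⁻¹ := by
            rw [e, mul_assoc, PowerSeries.mul_inv_cancel _ (G_ne cs U), mul_one]
          have e3 := PowerSeries.inv_mul_cancel _ (G_ne cs T)
          rw [e2]
          linear_combination (-(-1 : PowerSeries ℚ) ^ U.card * (G cs (par cs U))⁻¹) * e3
        rw [Finset.sum_congr rfl h3, ← Finset.mul_sum, h, mul_zero]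
      rw [← Finset.add_sum_erase _ _ (Finset.mem_powerset_self T)] at h2
      change _ + ∑ U ∈ T.ssubsets, _ = _ at h2
      have h4 : (G cs (par cs T))⁻¹ = (-1) ^ T.card *
          -∑ U ∈ T.ssubsets, (-1 : PowerSeries ℚ) ^ U.card * (G cs (par cs U))⁻¹ := by
        have e : ((-1 : PowerSeries ℚ) ^ T.card) * (-1) ^ T.card = 1 := by
          rw [← mul_pow]; simp
        linear_combination (-(G cs (par cs T))⁻¹) * e + (-1) ^ T.card * h2
      rw [h4]
      refine Good.sign (Good.neg (Good.sum _ _ fun U hU => Good.sign (ih U ?_) _)) _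
      exact Finset.mem_ssubsets.1 hU

theorem par_univ [Fintype B] : par cs Finset.univ = Set.univ := by
  ext w
  obtain ⟨a, -, rfl⟩ := cs.exists_isReduced w
  simp only [Set.mem_univ, iff_true]
  exact ⟨a, by simp, rfl⟩

end cox
end PDN

/-- if the Weyl group of the generalized Cartan matrix `A` is infinite
and its Coxeter graph is connected, then `deg P(A) ≥ 0`: for all nonzero polynomials
`Q, R` with `R · P(A) = Q` in `ℚ⟦t⟧`, `deg R ≤ deg Q`. -/
theorem poincare_deg_nonneg {n : ℕ} (A : Matrix (Fin n) (Fin n) ℤ) (hA : IsGCM A)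
    (hinf : Infinite (gcmCoxeter A).Group)
    (hconn : (coxeterGraph (gcmCoxeter A)).Connected) :
    ∀ Q R : Polynomial ℚ, Q ≠ 0 → R ≠ 0 →
      (R : PowerSeries ℚ) * coxPoincareQ (gcmCoxeter A) = (Q : PowerSeries ℚ) →
      R.natDegree ≤ Q.natDegree := by
  intro Q R hQ hR h
  obtain ⟨A', D, hD, hd, he⟩ := PDN.good_inv (gcmCoxeter A).toCoxeterSystem Finset.univ
  have hP : coxPoincareQ (gcmCoxeter A) =
      PDN.G (gcmCoxeter A).toCoxeterSystem (PDN.par (gcmCoxeter A).toCoxeterSystem Finset.univ) := by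
    rw [PDN.par_univ]
    simp [coxPoincareQ, PDN.G]
  rw [hP] at h
  have hinv := PowerSeries.mul_inv_cancel _ (PDN.G_ne (gcmCoxeter A).toCoxeterSystem Finset.univ)
  have key : A' * Q = R * D := by
    apply Polynomial.coe_injective
    push_cast
    rw [← h, ← he]
    linear_combination ((R : PowerSeries ℚ) * D) * hinv
  have hA' : A' ≠ 0 := by
    rintro rfl
    rw [zero_mul] at key
    exact mul_ne_zero hR hD key.symm
  have := congrArg Polynomial.natDegree key
  rw [Polynomial.natDegree_mul hA' hQ, Polynomial.natDegree_mul hR hD] at this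
  omega
end

section
/- Let A be an n×n generalized Cartan matrix. Then in ℚ⟦t⟧: P(A)^{−1} = ∑_{r=0}^{n−1} ∑_{T} H_T, where the inner sum is over all chains T : S = I_0 ⊋ I_1 ⊋ ⋯ ⊋ I_r ⊋ ∅ of length r, and H_T = ( ∏_{j=1}^{r} (−1)^{|I_j|} · (t^{D_{I_{j−1}}} + (−1)^{|I_{j−1}|+1})^{−1} ) · (t^{D_{I_r}} + (−1)^{|I_r|+1})^{−1}. -/
open PowerSeries

open scoped Classical

/-- The standard parabolic subgroup `W_I` of the Coxeter group of `M` generated by the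
simple reflections indexed by `I`. -/
def coxParabolic {n : ℕ} (M : CoxeterMatrix (Fin n)) (I : Finset (Fin n)) :
    Subgroup M.Group :=
  Subgroup.closure (M.toCoxeterSystem.simple '' I)

/-- The power series `t^{D_I}`, where `D_I` is the maximal length of an element of the
standard parabolic subgroup `W_I` when `W_I` is finite; when `W_I` is infinite the
expression is interpreted as `0`. -/
noncomputable def tD {n : ℕ} (M : CoxeterMatrix (Fin n)) (I : Finset (Fin n)) :
    PowerSeries ℚ :=
  if Finite (coxParabolic M I) then
    (PowerSeries.X : PowerSeries ℚ) ^
      (⨆ w : coxParabolic M I, M.toCoxeterSystem.length (w : M.Group))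
  else 0

/-- `c` encodes a chain `S = I₀ ⊋ I₁ ⊋ ⋯ ⊋ I_r ⊋ ∅` of subsets of `S = {1, …, n}`. -/
def IsGCMChain {n r : ℕ} (c : Fin (r + 1) → Finset (Fin n)) : Prop :=
  c 0 = Finset.univ ∧ StrictAnti c ∧ c (Fin.last r) ≠ ∅

/-- The contribution `H_T` of a chain `T` (encoded by `c`):
`H_T = (∏_{j=1}^{r} (−1)^{|I_j|}·(t^{D_{I_{j−1}}} + (−1)^{|I_{j−1}|+1})⁻¹)
  · (t^{D_{I_r}} + (−1)^{|I_r|+1})⁻¹`. -/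
noncomputable def chainTerm {n r : ℕ} (M : CoxeterMatrix (Fin n))
    (c : Fin (r + 1) → Finset (Fin n)) : PowerSeries ℚ :=
  (∏ j : Fin r, ((-1 : PowerSeries ℚ) ^ (c j.succ).card *
      (tD M (c j.castSucc) + (-1 : PowerSeries ℚ) ^ ((c j.castSucc).card + 1))⁻¹)) *
    (tD M (c (Fin.last r)) + (-1 : PowerSeries ℚ) ^ ((c (Fin.last r)).card + 1))⁻¹


namespace CoxAux
open CoxeterSystem

variable {B W : Type*} [Group W] {M : CoxeterMatrix B} (cs : CoxeterSystem M W)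

theorem end_mul_apply {α : Type*} (f g : Function.End α) (x : α) : (f * g) x = f (g x) := rfl

noncomputable def fgen (i : B) : Function.End (W × ZMod 2) :=
  fun p => (cs.simple i * p.1 * cs.simple i, p.2 + if p.1 = cs.simple i then 1 else 0)

theorem conj_pow_simple (i j : B) (k : ℕ) :
    cs.simple j * (cs.simple i * cs.simple j) ^ k =
      ((cs.simple i * cs.simple j) ^ k)⁻¹ * cs.simple j := by
  induction k with
  | zero => simp
  | succ k ih =>
    rw [pow_succ, ← mul_assoc, ih, ← pow_succ, pow_succ']
    simp [mul_assoc]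

theorem fgen_pow (i j : B) (k : ℕ) (p : W × ZMod 2) :
    ((fgen cs i * fgen cs j) ^ k : Function.End (W × ZMod 2)) p =
      ((cs.simple i * cs.simple j) ^ k * p.1 * ((cs.simple i * cs.simple j) ^ k)⁻¹,
        p.2 + ∑ l ∈ Finset.range (2 * k),
          if p.1 = cs.simple j * (cs.simple i * cs.simple j) ^ l then 1 else 0) := by
  induction k with
  | zero => simp [Function.End.one_def]
  | succ k ih =>
    have h1 := conj_pow_simple cs i j k
    rw [pow_succ', end_mul_apply, ih]
    set y := (cs.simple i * cs.simple j) ^ k with hy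
    have e1 : (y * p.1 * y⁻¹ = cs.simple j) ↔
        p.1 = cs.simple j * (cs.simple i * cs.simple j) ^ (2 * k) := by
      rw [two_mul, pow_add, ← hy, ← mul_assoc, h1]
      constructor
      · intro h; rw [← h]; group
      · intro h; rw [h]; group
    have e2 : (cs.simple j * (y * p.1 * y⁻¹) * cs.simple j = cs.simple i) ↔
        p.1 = cs.simple j * (cs.simple i * cs.simple j) ^ (2 * k + 1) := by
      have : cs.simple j * (cs.simple i * cs.simple j) ^ (2 * k + 1)
          = y⁻¹ * (cs.simple j * cs.simple i * cs.simple j) * y := by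
        rw [two_mul, pow_succ', pow_add, ← hy]
        have h2 : (cs.simple i * cs.simple j) * (y * y) = y * (cs.simple i * cs.simple j) * y := by
          rw [← mul_assoc, hy, ← pow_succ', ← pow_succ]
        rw [h2]
        simp only [← mul_assoc]
        rw [h1]
      rw [this]
      constructor
      · intro h; rw [← h]; simp [mul_assoc]
      · intro h; rw [h]; simp [mul_assoc]
    rw [end_mul_apply]
    simp only [fgen, e1, e2]
    rw [mul_add, mul_one, Finset.sum_range_succ, Finset.sum_range_succ, pow_succ' _ k, ← hy]
    refine Prod.ext ?_ ?_
    · simp [mul_assoc]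
    · simp only [add_assoc]

theorem fgen_liftable : M.IsLiftable (fgen cs) := by
  intro i j
  funext p
  rw [fgen_pow, cs.simple_mul_simple_pow, two_mul, Finset.sum_range_add]
  simp only [pow_add, cs.simple_mul_simple_pow, one_mul, CharTwo.add_self_eq_zero]
  simp [Function.End.one_def]

theorem lift_word (ω : List B) (p : W × ZMod 2) :
    cs.lift ⟨fgen cs, fgen_liftable cs⟩ (cs.wordProd ω) p =
      (cs.wordProd ω * p.1 * (cs.wordProd ω)⁻¹, p.2 + ((cs.rightInvSeq ω).count p.1 : ZMod 2)) := by
  induction ω with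
  | nil => simp [Function.End.one_def]
  | cons i ω ih =>
    rw [cs.wordProd_cons, map_mul, end_mul_apply, ih,
      cs.lift_apply_simple, rightInvSeq, List.count_cons]
    simp only [fgen]
    have : (cs.wordProd ω * p.1 * (cs.wordProd ω)⁻¹ = cs.simple i) ↔
       ((cs.wordProd ω)⁻¹ * cs.simple i * cs.wordProd ω == p.1) = true := by
      rw [beq_iff_eq]
      constructor
      · intro h; rw [← h]; group
      · intro h; rw [← h]; group
    simp only [this]
    refine Prod.ext ?_ ?_
    · simp [mul_assoc]
    · push_cast; simp only [add_assoc]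

/-- exchange condition -/
theorem exchange (ω : List B) (j : B)
    (h : cs.length (cs.wordProd ω * cs.simple j) < cs.length (cs.wordProd ω)) :
    ∃ k < ω.length, cs.wordProd ω * cs.simple j = cs.wordProd (ω.eraseIdx k) := by
  obtain ⟨ω', h1, h2⟩ := cs.exists_isReduced (cs.wordProd ω * cs.simple j)
  have h3 : cs.wordProd ω = cs.wordProd (ω'.concat j) := by
    rw [cs.wordProd_concat, ← h2]; simp
  have h4 : cs.IsReduced (ω'.concat j) := by
    have := cs.length_mul_simple (cs.wordProd ω) j
    rw [CoxeterSystem.IsReduced, ← h3, List.length_concat, ← h1.eq, ← h2]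
    omega
  have h5 : cs.simple j ∈ cs.rightInvSeq (ω'.concat j) := by
    rw [rightInvSeq_concat]; simp
  have h6 := List.count_eq_one_of_mem h4.nodup_rightInvSeq h5
  have h7 := lift_word cs ω (cs.simple j, 0)
  rw [h3, lift_word, ← h3, h6] at h7
  have h8 : cs.simple j ∈ cs.rightInvSeq ω := by
    by_contra hc
    rw [List.count_eq_zero_of_not_mem hc] at h7
    simp at h7
  obtain ⟨k, hk, hk'⟩ := List.mem_iff_getElem.mp h8
  refine ⟨k, by simpa using hk, ?_⟩
  rw [← cs.wordProd_mul_getD_rightInvSeq, List.getD_eq_getElem _ _ hk, hk']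

/-- standard parabolic -/
def par (J : Set B) : Subgroup W := Subgroup.closure (cs.simple '' J)

theorem par_mono {J I : Set B} (h : J ⊆ I) : par cs J ≤ par cs I :=
  Subgroup.closure_mono (Set.image_mono h)

theorem simple_mem_par {J : Set B} {j : B} (h : j ∈ J) : cs.simple j ∈ par cs J :=
  Subgroup.subset_closure ⟨j, h, rfl⟩

theorem word_mem_par {J : Set B} (ω : List B) (h : ∀ i ∈ ω, i ∈ J) : cs.wordProd ω ∈ par cs J := by
  induction ω with
  | nil => simp [one_mem]
  | cons i ω ih =>
    rw [cs.wordProd_cons]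
    exact mul_mem (simple_mem_par cs (h i (by simp))) (ih fun k hk => h k (by simp [hk]))

theorem exists_reduced_par_step {J : Set B} (ω : List B) (h : cs.IsReduced ω)
    (hJ : ∀ i ∈ ω, i ∈ J) (j : B) (hj : j ∈ J) :
    ∃ ω' : List B, cs.IsReduced ω' ∧ (∀ i ∈ ω', i ∈ J) ∧
      cs.wordProd ω * cs.simple j = cs.wordProd ω' := by
  rcases cs.length_mul_simple (cs.wordProd ω) j with h1 | h1
  · refine ⟨ω ++ [j], ?_, ?_, ?_⟩
    · rw [CoxeterSystem.IsReduced, cs.wordProd_append, cs.wordProd_singleton, h1, h.eq]; simp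
    · intro i hi
      rcases List.mem_append.mp hi with hi | hi
      · exact hJ i hi
      · rw [List.mem_singleton.mp hi]; exact hj
    · rw [cs.wordProd_append, cs.wordProd_singleton]
  · obtain ⟨k, hk, hk'⟩ := exchange cs ω j (by omega)
    refine ⟨ω.eraseIdx k, ?_, fun i hi => hJ i (List.mem_of_mem_eraseIdx hi), hk'⟩
    have := List.length_eraseIdx_add_one hk
    have := h.eq
    rw [CoxeterSystem.IsReduced, ← hk']
    omega

theorem exists_reduced_par {J : Set B} {v : W} (hv : v ∈ par cs J) :
    ∃ ω : List B, cs.IsReduced ω ∧ (∀ i ∈ ω, i ∈ J) ∧ v = cs.wordProd ω := by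
  unfold par at hv
  induction hv using Subgroup.closure_induction_right with
  | one => exact ⟨[], by simp [CoxeterSystem.IsReduced], by simp, by simp⟩
  | mul_right x hx y hy ih =>
    obtain ⟨ω, h1, h2, rfl⟩ := ih
    obtain ⟨j, hj, rfl⟩ := hy
    exact exists_reduced_par_step cs ω h1 h2 j hj
  | mul_inv_cancel x hx y hy ih =>
    obtain ⟨ω, h1, h2, rfl⟩ := ih
    obtain ⟨j, hj, rfl⟩ := hy
    rw [cs.inv_simple]
    exact exists_reduced_par_step cs ω h1 h2 j hj

theorem isReduced_append_left {ω : List B} {j : B} (h : cs.IsReduced (ω ++ [j])) :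
    cs.IsReduced ω := by
  have := CoxeterSystem.IsReduced.take h ω.length
  simpa using this

theorem exchange_append (μ ω : List B) (j : B) (hω : cs.IsReduced (ω ++ [j]))
    (h : cs.length (cs.wordProd (μ ++ ω) * cs.simple j) < cs.length (cs.wordProd (μ ++ ω))) :
    ∃ k < μ.length, cs.wordProd (μ ++ ω) * cs.simple j =
      cs.wordProd (μ.eraseIdx k) * cs.wordProd ω := by
  obtain ⟨k, hk, hk'⟩ := exchange cs (μ ++ ω) j h
  by_cases hlt : k < μ.length
  · refine ⟨k, hlt, ?_⟩
    rw [hk', List.eraseIdx_append_of_lt_length hlt, cs.wordProd_append]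
  · exfalso
    rw [List.length_append] at hk
    rw [List.eraseIdx_append_of_length_le (by omega), cs.wordProd_append, cs.wordProd_append,
      mul_assoc, mul_left_cancel_iff] at hk'
    have h1 := hω.eq
    rw [cs.wordProd_append, cs.wordProd_singleton, hk', List.length_append] at h1
    have h2 := cs.length_wordProd_le (ω.eraseIdx (k - μ.length))
    have := List.length_eraseIdx_add_one (l := ω) (i := k - μ.length) (by omega)
    simp at h1
    omega

theorem length_mul_of_min {J : Set B} {u : W}
    (hu : ∀ x ∈ par cs J, cs.length u ≤ cs.length (u * x)) (ω : List B) (hω : cs.IsReduced ω)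
    (hJ : ∀ i ∈ ω, i ∈ J) : cs.length (u * cs.wordProd ω) = cs.length u + ω.length := by
  induction ω using List.reverseRecOn with
  | nil => simp
  | append_singleton ω j ih =>
    have hω' := isReduced_append_left cs hω
    have hJ' : ∀ i ∈ ω, i ∈ J := fun i hi => hJ i (by simp [hi])
    have ih := ih hω' hJ'
    have hj : j ∈ J := hJ j (by simp)
    rw [cs.wordProd_append, cs.wordProd_singleton, ← mul_assoc, List.length_append]
    rcases cs.length_mul_simple (u * cs.wordProd ω) j with h1 | h1
    · rw [h1, ih]; simp; omega
    · exfalso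
      obtain ⟨μ, hμ, rfl⟩ := cs.exists_isReduced u
      rw [← cs.wordProd_append] at h1
      obtain ⟨k, hk, hk'⟩ := exchange_append cs μ ω j hω (by omega)
      have hw := word_mem_par cs ω hJ'
      have h2 := hu (cs.wordProd ω * cs.simple j * (cs.wordProd ω)⁻¹)
        (mul_mem (mul_mem hw (simple_mem_par cs hj)) (inv_mem hw))
      rw [cs.wordProd_append, mul_assoc] at hk'
      rw [← mul_assoc, hk', mul_inv_cancel_right, hμ.eq] at h2
      have h3 := cs.length_wordProd_le (μ.eraseIdx k)
      have := List.length_eraseIdx_add_one hk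
      omega

/-- minimal coset representatives -/
def minRep (J : Set B) : Set W := {u | ∀ j ∈ J, cs.length u < cs.length (u * cs.simple j)}

theorem length_mul_of_min' {J : Set B} {u v : W}
    (hu : ∀ x ∈ par cs J, cs.length u ≤ cs.length (u * x)) (hv : v ∈ par cs J) :
    cs.length (u * v) = cs.length u + cs.length v := by
  obtain ⟨ω, h1, h2, rfl⟩ := exists_reduced_par cs hv
  rw [length_mul_of_min cs hu ω h1 h2, h1.eq]

theorem exists_min (J : Set B) (w : W) : ∃ u, ∃ v ∈ par cs J, w = u * v ∧
    ∀ x ∈ par cs J, cs.length u ≤ cs.length (u * x) := by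
  have hne : {u : W | ∃ v ∈ par cs J, w = u * v}.Nonempty := ⟨w, 1, one_mem _, by simp⟩
  have hmin := fun y hy => not_lt.mp (WellFounded.not_lt_min (InvImage.wf cs.length Nat.lt_wfRel.wf) (x := y)
    {u : W | ∃ v ∈ par cs J, w = u * v} hy)
  obtain ⟨v, hv, hv'⟩ := WellFounded.min_mem (InvImage.wf cs.length Nat.lt_wfRel.wf) _ hne
  refine ⟨_, v, hv, hv', fun x hx => hmin _ ⟨x⁻¹ * v, mul_mem (inv_mem hx) hv, ?_⟩⟩
  refine hv'.trans ?_
  group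

theorem minRep_iff {J : Set B} {u : W} : u ∈ minRep cs J ↔
    ∀ x ∈ par cs J, cs.length u ≤ cs.length (u * x) := by
  constructor
  · intro hu
    obtain ⟨u0, v, hv, rfl, h0⟩ := exists_min cs J u
    obtain ⟨ω, h1, h2, rfl⟩ := exists_reduced_par cs hv
    rcases List.eq_nil_or_concat ω with rfl | ⟨ω', j, rfl⟩
    · simpa using h0
    · exfalso
      rw [List.concat_eq_append] at *
      have h3 := hu j (h2 j (by simp))
      rw [length_mul_of_min cs h0 _ h1 h2, cs.wordProd_append, cs.wordProd_singleton, mul_assoc,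
        cs.simple_mul_simple_cancel_right,
        length_mul_of_min cs h0 _ (isReduced_append_left cs h1) (fun i hi => h2 i (by simp [hi]))]
        at h3
      simp at h3
  · intro h j hj
    have := h _ (simple_mem_par cs hj)
    have := cs.length_mul_simple_ne u j
    omega

theorem length_minRep_mul {J : Set B} {u v : W} (hu : u ∈ minRep cs J) (hv : v ∈ par cs J) :
    cs.length (u * v) = cs.length u + cs.length v :=
  length_mul_of_min' cs ((minRep_iff cs).1 hu) hv

theorem exists_minRep (J : Set B) (w : W) : ∃ u ∈ minRep cs J, ∃ v ∈ par cs J, w = u * v := by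
  obtain ⟨u, v, hv, h, h'⟩ := exists_min cs J w
  exact ⟨u, (minRep_iff cs).2 h', v, hv, h⟩

theorem minRep_unique {J : Set B} {u v u' v' : W} (hu : u ∈ minRep cs J) (hv : v ∈ par cs J)
    (hu' : u' ∈ minRep cs J) (hv' : v' ∈ par cs J) (h : u * v = u' * v') : u = u' ∧ v = v' := by
  have hx : v * v'⁻¹ ∈ par cs J := mul_mem hv (inv_mem hv')
  have e : u' = u * (v * v'⁻¹) := by rw [← mul_assoc, h]; group
  have e' : u = u' * (v * v'⁻¹)⁻¹ := by rw [e]; group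
  have l1 := length_minRep_mul cs hu hx
  have l2 := length_minRep_mul cs hu' (inv_mem hx)
  rw [← e] at l1
  rw [← e'] at l2
  have : v * v'⁻¹ = 1 := cs.length_eq_zero_iff.1 (by omega)
  have hvv : v = v' := by rwa [mul_inv_eq_one] at this
  subst hvv
  exact ⟨mul_right_cancel h, rfl⟩

/-- all elements of `I` are descents -/
theorem top_word {I : Set B} {w : W}
    (hw : ∀ i ∈ I, ¬ cs.length w < cs.length (w * cs.simple i)) (ω : List B)
    (hω : cs.IsReduced ω) (hI : ∀ i ∈ ω, i ∈ I) :
    ∃ μ : List B, w = cs.wordProd (μ ++ ω) ∧ cs.IsReduced (μ ++ ω) := by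
  induction ω using List.reverseRecOn with
  | nil =>
    obtain ⟨μ, h1, h2⟩ := cs.exists_isReduced w
    exact ⟨μ, by simpa using h2, by simpa using h1⟩
  | append_singleton ω j ih =>
    obtain ⟨μ, h1, h2⟩ := ih (isReduced_append_left cs hω) (fun i hi => hI i (by simp [hi]))
    have h3 := hw j (hI j (by simp))
    have h4 := cs.length_mul_simple_ne w j
    have h5 : cs.length (w * cs.simple j) < cs.length w := by omega
    rw [h1] at h5
    obtain ⟨k, hk, hk'⟩ := exchange_append cs μ ω j hω h5
    have e : w = cs.wordProd (μ.eraseIdx k ++ (ω ++ [j])) := by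
      rw [cs.wordProd_append, cs.wordProd_append, cs.wordProd_singleton, ← mul_assoc, ← hk', h1]
      simp
    refine ⟨μ.eraseIdx k, e, ?_⟩
    have := List.length_eraseIdx_add_one hk
    have h6 := h2.eq
    rw [← h1] at h6
    rw [CoxeterSystem.IsReduced, ← e, h6]
    simp
    omega

theorem top_par {I : Set B} {w : W}
    (hw : ∀ i ∈ I, ¬ cs.length w < cs.length (w * cs.simple i)) {v : W} (hv : v ∈ par cs I) :
    ∃ x, w = x * v ∧ cs.length w = cs.length x + cs.length v := by
  obtain ⟨ω, h1, h2, rfl⟩ := exists_reduced_par cs hv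
  obtain ⟨μ, h3, h4⟩ := top_word cs hw ω h1 h2
  refine ⟨cs.wordProd μ, by rw [h3, cs.wordProd_append], ?_⟩
  have h5 := h4.eq
  rw [← h3, List.length_append] at h5
  have h6 := CoxeterSystem.IsReduced.take h4 μ.length
  simp only [List.take_left'] at h6
  rw [h5, h1.eq, h6.eq]

theorem finite_length [Finite B] (k : ℕ) : {w : W | cs.length w ≤ k}.Finite := by
  refine ((List.finite_length_le B k).image cs.wordProd).subset ?_
  intro w hw
  obtain ⟨ω, h1, rfl⟩ := cs.exists_isReduced w
  exact ⟨ω, by simpa [h1.eq] using hw, rfl⟩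

section gen
variable [Finite B]

theorem finite_length_eq (k : ℕ) : {w : W | cs.length w = k}.Finite :=
  (finite_length cs k).subset fun _ h => le_of_eq h

noncomputable def lens (k : ℕ) : Finset W := (finite_length_eq cs k).toFinset

theorem mem_lens {k : ℕ} {w : W} : w ∈ lens cs k ↔ cs.length w = k := by simp [lens]

noncomputable def gf (S : Set W) : PowerSeries ℚ :=
  PowerSeries.mk fun k => (((lens cs k).filter (· ∈ S)).card : ℚ)

theorem gf_mul {J I : Set B} (h : J ⊆ I) :
    gf cs (par cs I) = gf cs (par cs I ∩ minRep cs J) * gf cs (par cs J) := by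
  ext k
  rw [PowerSeries.coeff_mul]
  simp only [gf, PowerSeries.coeff_mk]
  norm_cast
  simp only [← Finset.card_product]
  rw [← Finset.card_sigma]
  symm
  refine Finset.card_bij (fun p _ => p.2.1 * p.2.2) ?_ ?_ ?_
  · rintro ⟨⟨a, b⟩, u, v⟩ hp
    simp only [Finset.mem_sigma, Finset.mem_product, Finset.mem_filter,
      mem_lens, Set.mem_inter_iff, SetLike.mem_coe] at hp ⊢
    obtain ⟨hk, ⟨hu, hu1, hu2⟩, hv, hv1⟩ := hp
    exact ⟨by rw [length_minRep_mul cs hu2 hv1, hu, hv]; exact Finset.HasAntidiagonal.mem_antidiagonal.1 hk, mul_mem hu1 (par_mono cs h hv1)⟩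
  · rintro ⟨⟨a, b⟩, u, v⟩ hp ⟨⟨a', b'⟩, u', v'⟩ hp' heq
    simp only [Finset.mem_sigma, Finset.mem_product, Finset.mem_filter,
      mem_lens, Set.mem_inter_iff, SetLike.mem_coe] at hp hp' heq
    obtain ⟨hk, ⟨hu, hu1, hu2⟩, hv, hv1⟩ := hp
    obtain ⟨hk', ⟨hu', hu1', hu2'⟩, hv', hv1'⟩ := hp'
    obtain ⟨rfl, rfl⟩ := minRep_unique cs hu2 hv1 hu2' hv1' heq
    subst hu hv hu' hv'
    rfl
  · intro w hw
    simp only [Finset.mem_filter, mem_lens, SetLike.mem_coe] at hw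
    obtain ⟨hk, hw⟩ := hw
    obtain ⟨u, hu, v, hv, rfl⟩ := exists_minRep cs J w
    refine ⟨⟨(cs.length u, cs.length v), u, v⟩, ?_, rfl⟩
    simp only [Finset.mem_sigma, Finset.mem_product, Finset.mem_filter,
      mem_lens, Set.mem_inter_iff, SetLike.mem_coe]
    refine ⟨Finset.HasAntidiagonal.mem_antidiagonal.2 (by rw [← hk, length_minRep_mul cs hu hv]), ⟨trivial, ?_, hu⟩, trivial, hv⟩
    have := mul_mem hw (inv_mem (par_mono cs h hv))
    simpa using this

/-- elements of `W_I` all of whose `I`-steps are descents -/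
def tops (I : Set B) : Set W :=
  {w | w ∈ par cs I ∧ ∀ i ∈ I, ¬ cs.length w < cs.length (w * cs.simple i)}

theorem gf_alt (I : Finset B) :
    ∑ J ∈ I.powerset, (-1 : PowerSeries ℚ) ^ J.card * gf cs (par cs (I : Set B) ∩ minRep cs (J : Set B))
      = gf cs (tops cs (I : Set B)) := by
  ext k
  rw [map_sum]
  have h0 : ∀ (m : ℕ) (f : PowerSeries ℚ), PowerSeries.coeff k ((-1) ^ m * f) =
      (-1) ^ m * PowerSeries.coeff k f := by
    intro m f
    rcases neg_one_pow_eq_or (PowerSeries ℚ) m with h | h <;>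
      rcases Nat.even_or_odd m with h' | h' <;> simp [h'.neg_one_pow]
  simp only [h0, gf, PowerSeries.coeff_mk, Finset.card_filter, Nat.cast_sum, Finset.mul_sum]
  rw [Finset.sum_comm]
  refine Finset.sum_congr rfl fun w _ => ?_
  by_cases hw : w ∈ par cs (I : Set B)
  · set A := I.filter (fun i => cs.length w < cs.length (w * cs.simple i)) with hA
    have h1 : ∑ J ∈ I.powerset, (-1 : ℚ) ^ J.card *
        ((if w ∈ (par cs (I : Set B) : Set W) ∩ minRep cs (J : Set B) then 1 else 0 : ℕ) : ℚ) =
        ∑ J ∈ A.powerset, (-1 : ℚ) ^ J.card := by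
      have hs : A.powerset ⊆ I.powerset := Finset.powerset_mono.2 (Finset.filter_subset _ _)
      rw [← Finset.sum_subset hs]
      · refine Finset.sum_congr rfl fun J hJ => ?_
        rw [if_pos]
        · simp
        · refine ⟨hw, fun j hj => ?_⟩
          exact (Finset.mem_filter.1 (Finset.mem_powerset.1 hJ hj)).2
      · intro J hJ hJ'
        rw [if_neg]
        · simp
        · rintro ⟨-, h⟩
          apply hJ'
          rw [Finset.mem_powerset] at hJ ⊢
          exact fun j hj => Finset.mem_filter.2 ⟨hJ hj, h j hj⟩
    refine Eq.trans (Eq.trans (by congr!) h1) ?_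
    have h2 := Finset.sum_powerset_neg_one_pow_card (x := A)
    have h3 := congrArg (Int.cast : ℤ → ℚ) h2
    push_cast at h3
    rw [h3]
    have : A = ∅ ↔ w ∈ tops cs (I : Set B) := by
      rw [hA, Finset.filter_eq_empty_iff]
      simp [tops, hw]
    simp [this]
  · have : w ∉ tops cs (I : Set B) := fun h => hw h.1
    simp [hw, this]

theorem gf_tops (I : Set B) : gf cs (tops cs I) = if Finite (par cs I) then
    (PowerSeries.X : PowerSeries ℚ) ^ (⨆ w : par cs I, cs.length (w : W)) else 0 := by
  have key : ∀ w ∈ tops cs I, ∀ v ∈ par cs I, cs.length v ≤ cs.length w := by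
    intro w hw v hv
    obtain ⟨x, -, h⟩ := top_par cs hw.2 hv
    omega
  have uniq : ∀ w ∈ tops cs I, ∀ v ∈ tops cs I, v = w := by
    intro w hw v hv
    obtain ⟨x, h', h⟩ := top_par cs hw.2 hv.1
    have := key v hv w hw.1
    have : x = 1 := cs.length_eq_zero_iff.1 (by omega)
    rw [h', this, one_mul]
  split_ifs with hf
  · obtain ⟨w, hw⟩ := Finite.exists_max (fun w : par cs I => cs.length (w : W))
    have hbdd : BddAbove (Set.range fun w : par cs I => cs.length (w : W)) :=
      ⟨_, by rintro _ ⟨v, rfl⟩; exact hw v⟩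
    have hsup : (⨆ w : par cs I, cs.length (w : W)) = cs.length (w : W) :=
      le_antisymm (ciSup_le hw) (le_ciSup hbdd w)
    have hwt : (w : W) ∈ tops cs I := by
      refine ⟨w.2, fun i hi => not_lt.2 ?_⟩
      exact hw ⟨w * cs.simple i, mul_mem w.2 (simple_mem_par cs hi)⟩
    rw [hsup]
    ext k
    rw [PowerSeries.coeff_X_pow, gf, PowerSeries.coeff_mk]
    split_ifs with hk
    · have : (lens cs k).filter (· ∈ tops cs I) = {(w : W)} := by
        ext v
        simp only [Finset.mem_filter, mem_lens, Finset.mem_singleton]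
        constructor
        · rintro ⟨-, hv⟩; exact uniq _ hwt _ hv
        · rintro rfl; exact ⟨hk.symm, hwt⟩
      rw [this]; simp
    · have : (lens cs k).filter (· ∈ tops cs I) = ∅ := by
        rw [Finset.filter_eq_empty_iff]
        intro v hv hv'
        rw [mem_lens] at hv
        rw [uniq _ hwt _ hv'] at hv
        exact hk hv.symm
      rw [this]; simp
  · ext k
    rw [gf, PowerSeries.coeff_mk]
    have : (lens cs k).filter (· ∈ tops cs I) = ∅ := by
      rw [Finset.filter_eq_empty_iff]
      intro v hv hv'
      apply hf
      have := (finite_length cs (cs.length v)).subset (t := (par cs I : Set W)) (key v hv')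
      exact this.to_subtype
    rw [this]; simp

theorem gf_par_coeff (I : Set B) : PowerSeries.constantCoeff (gf cs (par cs I)) = 1 := by
  rw [← PowerSeries.coeff_zero_eq_constantCoeff_apply, gf, PowerSeries.coeff_mk]
  have : (lens cs 0).filter (· ∈ (par cs I : Set W)) = {1} := by
    ext v
    simp only [Finset.mem_filter, mem_lens, Finset.mem_singleton, cs.length_eq_zero_iff]
    constructor
    · exact fun h => h.1
    · rintro rfl; exact ⟨rfl, one_mem _⟩
  rw [this]; simp

theorem gf_par_empty : gf cs (par cs ((∅ : Finset B) : Set B)) = 1 := by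
  ext k
  rw [gf, PowerSeries.coeff_mk, PowerSeries.coeff_one]
  have h1 : ∀ v, v ∈ (par cs ((∅ : Finset B) : Set B) : Set W) ↔ v = 1 := by
    simp [par]
  split_ifs with hk
  · have : (lens cs k).filter (· ∈ (par cs ((∅ : Finset B) : Set B) : Set W)) = {1} := by
      ext v
      simp only [Finset.mem_filter, mem_lens, Finset.mem_singleton, h1]
      constructor
      · exact fun h => h.2
      · rintro rfl; simp [hk]
    rw [this]; simp
  · have : (lens cs k).filter (· ∈ (par cs ((∅ : Finset B) : Set B) : Set W)) = ∅ := by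
      rw [Finset.filter_eq_empty_iff]
      intro v hv hv'
      rw [mem_lens, (h1 v).1 hv'] at hv
      simp at hv
      exact hk hv.symm
    rw [this]; simp

/-- the basic recursion -/
theorem gf_rec (I : Finset B) :
    gf cs (tops cs (I : Set B)) * (gf cs (par cs (I : Set B)))⁻¹ =
      ∑ J ∈ I.powerset, (-1 : PowerSeries ℚ) ^ J.card * (gf cs (par cs (J : Set B)))⁻¹ := by
  rw [← gf_alt, Finset.sum_mul]
  refine Finset.sum_congr rfl fun J hJ => ?_
  have h := gf_mul cs (J := (J : Set B)) (I := (I : Set B))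
    (Finset.coe_subset.2 (Finset.mem_powerset.1 hJ))
  have hI := PowerSeries.mul_inv_cancel _ (by rw [gf_par_coeff cs (I : Set B)]; exact one_ne_zero)
  have hJ := PowerSeries.mul_inv_cancel _ (by rw [gf_par_coeff cs (J : Set B)]; exact one_ne_zero)
  set a := gf cs (par cs (I : Set B))
  set b := gf cs (par cs (J : Set B))
  set c := gf cs (par cs (I : Set B) ∩ minRep cs (J : Set B))
  calc (-1) ^ J.card * c * a⁻¹ = (-1) ^ J.card * (c * (b * b⁻¹)) * a⁻¹ := by rw [hJ, mul_one]
    _ = (-1) ^ J.card * b⁻¹ * ((c * b) * a⁻¹) := by ring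
    _ = _ := by rw [← h, hI, mul_one]

theorem gf_tops_const {I : Finset B} (hI : I.Nonempty) :
    PowerSeries.constantCoeff (gf cs (tops cs (I : Set B))) = 0 := by
  rw [← PowerSeries.coeff_zero_eq_constantCoeff_apply, gf, PowerSeries.coeff_mk]
  rw [Nat.cast_eq_zero, Finset.card_eq_zero, Finset.filter_eq_empty_iff]
  rintro v hv hv'
  obtain ⟨i, hi⟩ := hI
  have := hv'.2 i hi
  rw [mem_lens] at hv
  have := cs.length_mul_simple_ne v i
  omega

theorem gf_rec' {I : Finset B} (hI : I.Nonempty) :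
    (gf cs (par cs (I : Set B)))⁻¹ =
      (gf cs (tops cs (I : Set B)) + (-1) ^ (I.card + 1))⁻¹ *
       (1 + ∑ J ∈ I.ssubsets.filter (·.Nonempty),
          (-1 : PowerSeries ℚ) ^ J.card * (gf cs (par cs (J : Set B)))⁻¹) := by
  have h := gf_rec cs I
  have e1 : I.powerset = insert I I.ssubsets := by
    ext J; simp [subset_iff_ssubset_or_eq, or_comm]
  rw [e1, Finset.sum_insert (by simp)] at h
  have e2 : I.ssubsets = insert ∅ (I.ssubsets.filter (·.Nonempty)) := by
    ext J
    rcases J.eq_empty_or_nonempty with rfl | hJ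
    · simp [hI.ne_empty, Finset.empty_ssubset, hI]
    · simp [hJ, hJ.ne_empty]
  rw [e2, Finset.sum_insert (by simp), gf_par_empty] at h
  have hu : PowerSeries.constantCoeff (gf cs (tops cs (I : Set B)) + (-1) ^ (I.card + 1)) ≠ 0 := by
    rw [map_add, gf_tops_const cs hI]
    simp
  have hc := PowerSeries.inv_mul_cancel _ hu
  simp only [Finset.card_empty, pow_zero, inv_one, mul_one] at h
  set q := gf cs (tops cs (I : Set B))
  set a := (gf cs (par cs (I : Set B)))⁻¹
  have : (q + (-1) ^ (I.card + 1)) * a = 1 + ∑ J ∈ I.ssubsets.filter (·.Nonempty),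
          (-1 : PowerSeries ℚ) ^ J.card * (gf cs (par cs (J : Set B)))⁻¹ := by
    rw [add_mul, h]; ring
  rw [← this, ← mul_assoc, hc, one_mul]

end gen


def IsChainFrom {n r : ℕ} (I : Finset (Fin n)) (c : Fin (r + 1) → Finset (Fin n)) : Prop :=
  c 0 = I ∧ StrictAnti c ∧ c (Fin.last r) ≠ ∅

theorem tD_eq {n : ℕ} (M : CoxeterMatrix (Fin n)) (I : Finset (Fin n)) :
    tD M I = gf M.toCoxeterSystem (tops M.toCoxeterSystem (I : Set (Fin n))) := by
  rw [gf_tops]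
  rfl

theorem isChainFrom_cons {n r : ℕ} (I J : Finset (Fin n)) (c : Fin (r + 1) → Finset (Fin n)) :
    IsChainFrom I (Fin.cons J c : Fin (r + 2) → Finset (Fin n)) ↔
      J = I ∧ c 0 ⊂ J ∧ IsChainFrom (c 0) c := by
  have hl : (Fin.cons J c : Fin (r + 2) → Finset (Fin n)) (Fin.last (r + 1)) = c (Fin.last r) := by
    rw [← Fin.succ_last, Fin.cons_succ]
  unfold IsChainFrom
  rw [hl, Fin.cons_zero]
  have : StrictAnti (Fin.cons J c : Fin (r + 2) → Finset (Fin n)) ↔ c 0 ⊂ J ∧ StrictAnti c := by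
    rw [Fin.strictAnti_iff_succ_lt, Fin.forall_fin_succ]
    refine and_congr ?_ ?_
    · simp
    · rw [Fin.strictAnti_iff_succ_lt]
      simp only [Fin.cons_succ, ← Fin.succ_castSucc]
  rw [this]
  tauto

theorem chainTerm_cons {n r : ℕ} (M : CoxeterMatrix (Fin n)) (J : Finset (Fin n))
    (c : Fin (r + 1) → Finset (Fin n)) :
    chainTerm M (Fin.cons J c : Fin (r + 2) → Finset (Fin n)) =
      (tD M J + (-1 : PowerSeries ℚ) ^ (J.card + 1))⁻¹ *
        ((-1 : PowerSeries ℚ) ^ (c 0).card * chainTerm M c) := by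
  have hl : (Fin.cons J c : Fin (r + 2) → Finset (Fin n)) (Fin.last (r + 1)) = c (Fin.last r) := by
    rw [← Fin.succ_last, Fin.cons_succ]
  unfold chainTerm
  rw [hl, Fin.prod_univ_succ]
  simp only [Fin.cons_succ, ← Fin.succ_castSucc, Fin.castSucc_zero, Fin.cons_zero]
  ring

theorem sum_chain_succ {n r : ℕ} (M : CoxeterMatrix (Fin n)) (I : Finset (Fin n)) :
    (∑ c : Fin (r + 2) → Finset (Fin n), if IsChainFrom I c then chainTerm M c else 0) =
      (tD M I + (-1 : PowerSeries ℚ) ^ (I.card + 1))⁻¹ *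
       ∑ J ∈ I.ssubsets.filter (·.Nonempty), (-1 : PowerSeries ℚ) ^ J.card *
        ∑ c : Fin (r + 1) → Finset (Fin n), if IsChainFrom J c then chainTerm M c else 0 := by
  rw [← (Fin.consEquiv (fun _ : Fin (r + 2) => Finset (Fin n))).sum_comp, Fintype.sum_prod_type]
  rw [Finset.sum_eq_single I]
  · simp only [Finset.mul_sum]
    rw [Finset.sum_comm]
    refine Finset.sum_congr rfl fun c _ => ?_
    change (if IsChainFrom I (Fin.cons I c : Fin (r + 2) → Finset (Fin n)) then
      chainTerm M (Fin.cons I c : Fin (r + 2) → Finset (Fin n)) else 0) = _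
    rw [isChainFrom_cons, chainTerm_cons]
    by_cases h : c 0 ⊂ I ∧ IsChainFrom (c 0) c
    · rw [if_pos ⟨rfl, h⟩, Finset.sum_eq_single (c 0)]
      · rw [if_pos h.2]
      · intro J _ hJ
        rw [if_neg (fun h' => hJ h'.1.symm)]; simp
      · intro hJ
        exfalso
        apply hJ
        rw [Finset.mem_filter, Finset.mem_ssubsets]
        refine ⟨h.1, ?_⟩
        have h2 := h.2.2.1.antitone (Fin.zero_le (Fin.last r))
        exact (Finset.nonempty_iff_ne_empty.2 h.2.2.2).mono h2
    · rw [if_neg (fun h' => h h'.2)]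
      symm
      apply Finset.sum_eq_zero
      intro J hJ
      rw [if_neg]
      · simp
      · intro h'
        apply h
        have e := h'.1
        subst e
        exact ⟨Finset.mem_ssubsets.1 (Finset.mem_filter.1 hJ).1, h'⟩
  · intro J _ hJ
    apply Finset.sum_eq_zero
    intro c _
    change (if IsChainFrom I (Fin.cons J c : Fin (r + 2) → Finset (Fin n)) then
      chainTerm M (Fin.cons J c : Fin (r + 2) → Finset (Fin n)) else 0) = _
    rw [isChainFrom_cons, if_neg (fun h => hJ h.1)]
  · simp

theorem sum_chain_zero {n : ℕ} (M : CoxeterMatrix (Fin n)) (I : Finset (Fin n)) (hI : I.Nonempty) :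
    (∑ c : Fin (0 + 1) → Finset (Fin n), if IsChainFrom I c then chainTerm M c else 0) =
      (tD M I + (-1 : PowerSeries ℚ) ^ (I.card + 1))⁻¹ := by
  haveI : Subsingleton (Fin (0 + 1)) := inferInstanceAs (Subsingleton (Fin 1))
  rw [Finset.sum_eq_single (fun _ => I)]
  · rw [if_pos]
    · simp [chainTerm]
    · exact ⟨rfl, Subsingleton.strictAnti _, hI.ne_empty⟩
  · intro c _ hc
    rw [if_neg]
    intro h
    apply hc
    funext i
    rw [Subsingleton.elim i 0]
    exact h.1
  · simp

theorem main_chain {n : ℕ} (M : CoxeterMatrix (Fin n)) (N : ℕ) (I : Finset (Fin n))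
    (hI : I.Nonempty) (hN : I.card ≤ N) :
    (gf M.toCoxeterSystem (par M.toCoxeterSystem (I : Set (Fin n))))⁻¹ =
      ∑ r ∈ Finset.range N, ∑ c : Fin (r + 1) → Finset (Fin n),
        if IsChainFrom I c then chainTerm M c else 0 := by
  induction N generalizing I with
  | zero => exact absurd (Finset.card_pos.2 hI) (by omega)
  | succ N ih =>
    rw [Finset.sum_range_succ', sum_chain_zero M I hI]
    simp only [sum_chain_succ]
    rw [← Finset.mul_sum, Finset.sum_comm, gf_rec' _ hI, ← tD_eq, mul_add, mul_one, add_comm]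
    congr 2
    refine Finset.sum_congr (by congr!) fun J hJ => ?_
    rw [Finset.mem_filter, Finset.mem_ssubsets] at hJ
    rw [ih J hJ.2 (by have := Finset.card_lt_card hJ.1; omega), Finset.mul_sum]

theorem coxPoincareQ_eq {n : ℕ} (M : CoxeterMatrix (Fin n)) :
    coxPoincareQ M = gf M.toCoxeterSystem
      (par M.toCoxeterSystem ((Finset.univ : Finset (Fin n)) : Set (Fin n))) := by
  have htop : par M.toCoxeterSystem ((Finset.univ : Finset (Fin n)) : Set (Fin n)) = ⊤ := by
    rw [par, Finset.coe_univ, Set.image_univ, CoxeterSystem.subgroup_closure_range_simple]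
  ext k
  rw [coxPoincareQ, gf, PowerSeries.coeff_mk, PowerSeries.coeff_mk, htop]
  congr 1
  rw [Nat.subtype_card]
  intro w
  simp [mem_lens]

end CoxAux

/-- for an `n × n` generalized Cartan matrix `A`,
`P(A)⁻¹ = ∑_{r=0}^{n−1} ∑_{T chain of length r} H_T`. -/
theorem poincare_inv_eq_sum_chains {n : ℕ} (hn : 1 ≤ n)
    (A : Matrix (Fin n) (Fin n) ℤ) (hA : IsGCM A) :
    (coxPoincareQ (gcmCoxeter A))⁻¹ =
      ∑ r ∈ Finset.range n, ∑ c : Fin (r + 1) → Finset (Fin n),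
        if IsGCMChain c then chainTerm (gcmCoxeter A) c else 0 := by
  rw [CoxAux.coxPoincareQ_eq]
  exact CoxAux.main_chain (gcmCoxeter A) n Finset.univ
    ⟨⟨0, hn⟩, Finset.mem_univ _⟩ (by simp)
end
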